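/- arXiv:0911.5620 — 7 statements merged into one kernel-verified Lean document; each statement's English description precedes it below -/
import Mathlib

section
/- Let Z_1 = {z_1} be a separating subset of a finite poset P consisting of a single element. Then the Greene sum of P factorizes as G(P) = G(P^≺ ∪ z_1) · G(P^≻ ∪ z_1). -/
open scoped Classical

noncomputable section

/-- The position `m` (as an element of `Fin n`) for `m : Fin (n-1)`. -/
def idxLo {n : ℕ} (m : Fin (n - 1)) : Fin n := ⟨m.1, by have := m.2; omega⟩

/-- The position `m+1` (as an element of `Fin n`) for `m : Fin (n-1)`. -/
def idxHi {n : ℕ} (m : Fin (n - 1)) : Fin n := ⟨m.1 + 1, by have := m.2; omega⟩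

/-- The Greene sum of a finite poset, given by a strict order relation `r`
(`r u v` means `u ≺ v`) on a finite index type `ι`, with variables `x : ι → K`:
the sum over all linear extensions (words listing the elements from maximal to
minimal) of the product of the inverses of consecutive differences. -/
def greeneSum {ι : Type*} [Fintype ι] {K : Type*} [Field K]
    (r : ι → ι → Prop) (x : ι → K) : K :=
  ∑ α : Equiv.Perm (Fin (Fintype.card ι)),
    if ∀ i j : Fin (Fintype.card ι),
        r ((Fintype.equivFin ι).symm (α i)) ((Fintype.equivFin ι).symm (α j)) → j < i
    then ∏ m : Fin (Fintype.card ι - 1),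
        (x ((Fintype.equivFin ι).symm (α (idxLo m))) -
          x ((Fintype.equivFin ι).symm (α (idxHi m))))⁻¹
    else 0

/-- `Z` is a separating subset of the poset `(ι, r)`: elements of `Z` are pairwise
incomparable and every element outside `Z` is either below every element of `Z` or
above every element of `Z`. -/
def IsSeparating {ι : Type*} (r : ι → ι → Prop) (Z : Set ι) : Prop :=
  (∀ a ∈ Z, ∀ b ∈ Z, a ≠ b → ¬ r a b ∧ ¬ r b a) ∧
  ∀ u ∉ Z, (∀ a ∈ Z, r u a) ∨ (∀ a ∈ Z, r a u)

/-- `P^≺`: the set of elements lying below every element of `Z`. -/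
def below {ι : Type*} (r : ι → ι → Prop) (Z : Set ι) : Set ι := {u | ∀ a ∈ Z, r u a}

/-- `P^≻`: the set of elements lying above every element of `Z`. -/
def above {ι : Type*} (r : ι → ι → Prop) (Z : Set ι) : Set ι := {u | ∀ a ∈ Z, r a u}

/-- Adjoin a new minimum (the element `none`) to a poset. -/
def adjoinMin {ι : Type*} (r : ι → ι → Prop) : Option ι → Option ι → Prop
  | none, some _ => True
  | some a, some b => r a b
  | _, _ => False

/-- Adjoin a new maximum (the element `none`) to a poset. -/
def adjoinMax {ι : Type*} (r : ι → ι → Prop) : Option ι → Option ι → Prop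
  | some _, none => True
  | some a, some b => r a b
  | _, _ => False

/-- Extend variables `x : ι → K` to `Option ι` by assigning the value `z` to the
adjoined element `none`. -/
def extendVar {ι K : Type*} (x : ι → K) (z : K) : Option ι → K
  | none => z
  | some a => x a

/-- The Newton divided difference `Δ_{Z_k}[φ]` at the nodes `z 1, …, z k`. -/
def dividedDiff {K : Type*} [Field K] {k : ℕ} (z : Fin k → K) (φ : K → K) : K :=
  ∑ j : Fin k, φ (z j) * (∏ i ∈ Finset.univ.erase j, (z j - z i))⁻¹


/-- The product of the inverses of the consecutive differences along a word. -/
def wordWeight {ι K : Type*} [Field K] (x : ι → K) : List ι → K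
  | a :: b :: l => (x a - x b)⁻¹ * wordWeight x (b :: l)
  | _ => 1

/-- The words listing the elements of `s` without repetition from maximal to minimal. -/
def linearWords {ι : Type*} (r : ι → ι → Prop) (s : Finset ι) : Finset (List ι) :=
  s.toList.permutations.toFinset.filter (List.Pairwise fun a b => ¬ r a b)

theorem mem_linearWords {ι : Type*} {r : ι → ι → Prop} {s : Finset ι} {l : List ι} :
    l ∈ linearWords r s ↔
      l.Nodup ∧ (∀ a, a ∈ l ↔ a ∈ s) ∧ l.Pairwise (fun a b => ¬ r a b) := by
  simp only [linearWords, Finset.mem_filter, List.mem_toFinset, List.mem_permutations, ← and_assoc]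
  refine and_congr_left fun _ => ⟨fun h => ?_, fun h => ?_⟩
  · exact ⟨h.nodup_iff.2 s.nodup_toList, fun a => h.mem_iff.trans Finset.mem_toList⟩
  · exact (List.perm_ext_iff_of_nodup h.1 s.nodup_toList).2 (by simpa using h.2)

@[simp]
theorem linearWords_empty {ι : Type*} (r : ι → ι → Prop) :
    linearWords r ∅ = {[]} := by
  ext l
  rw [mem_linearWords, Finset.mem_singleton]
  constructor
  · rintro ⟨-, h, -⟩
    exact List.eq_nil_iff_forall_not_mem.2 (by simpa using h)
  · rintro rfl
    simp

theorem wordWeight_append_cons {ι K : Type*} [Field K] (x : ι → K) (z : ι) (l₁ l₂ : List ι) :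
    wordWeight x (l₁ ++ z :: l₂) = wordWeight x (l₁ ++ [z]) * wordWeight x (z :: l₂) := by
  induction l₁ with
  | nil => simp [wordWeight]
  | cons a l ih =>
    cases l with
    | nil => simp [wordWeight]
    | cons b l =>
      simp only [List.cons_append, wordWeight] at ih ⊢
      rw [ih, mul_assoc]

theorem wordWeight_ofFn {ι K : Type*} [Field K] (x : ι → K) {n : ℕ} (g : Fin n → ι) :
    wordWeight x (List.ofFn g) =
      ∏ m : Fin (n - 1), (x (g (idxLo m)) - x (g (idxHi m)))⁻¹ := by
  induction n with
  | zero => simp [wordWeight]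
  | succ n ih =>
    cases n with
    | zero => simp [wordWeight]
    | succ n =>
      have h := ih fun i => g i.succ
      rw [List.ofFn_succ] at h
      rw [List.ofFn_succ, List.ofFn_succ, wordWeight, h]
      exact (Fin.prod_univ_succ (n := n)
        fun m => (x (g (idxLo (n := n + 2) m)) - x (g (idxHi (n := n + 2) m)))⁻¹).symm

/-- The Greene sum of a poset embedded in `(ι, r)`, computed over words in `ι`. -/
theorem greeneSum_eq_sum_linearWords {ι κ K : Type*} [Fintype κ] [Field K]
    {r : ι → ι → Prop} [Std.Irrefl r] {q : κ → κ → Prop} {x : ι → K} {y : κ → K}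
    {s : Finset ι} (f : κ → ι) (hf : Function.Injective f)
    (hs : ∀ a, a ∈ s ↔ a ∈ Set.range f) (hq : ∀ a b, q a b ↔ r (f a) (f b))
    (hy : ∀ a, y a = x (f a)) :
    greeneSum q y = ∑ l ∈ linearWords r s, wordWeight x l := by
  rw [greeneSum, ← Finset.sum_filter]
  set e := (Fintype.equivFin κ).symm
  have hinj (α : Equiv.Perm (Fin (Fintype.card κ))) :
      Function.Injective fun i => f (e (α i)) :=
    hf.comp (e.injective.comp α.injective)
  refine Finset.sum_bij (fun α _ => List.ofFn fun i => f (e (α i))) ?_ ?_ ?_ ?_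
  · intro α hα
    have hα := (Finset.mem_filter.1 hα).2
    refine mem_linearWords.2 ⟨List.nodup_ofFn.2 (hinj α), fun a => ?_, ?_⟩
    · rw [List.mem_ofFn', hs]
      exact Set.ext_iff.1 ((α.trans e).surjective.range_comp f) a
    · rw [List.pairwise_ofFn]
      intro i j hij h
      exact (hα i j ((hq _ _).2 h)).not_gt hij
  · intro α _ β _ h
    ext1 i
    exact e.injective (hf (congrFun (List.ofFn_injective h) i))
  · intro l hl
    obtain ⟨hnd, hmem, hpw⟩ := mem_linearWords.1 hl
    have hex (i : Fin l.length) : ∃ k, f k = l.get i :=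
      (hs _).1 ((hmem _).1 (l.get_mem i))
    choose g hg using hex
    have hgb : Function.Bijective g := by
      refine ⟨fun i j h => hnd.injective_get ?_, fun k => ?_⟩
      · rw [← hg, ← hg, h]
      · obtain ⟨i, hi⟩ := List.get_of_mem ((hmem (f k)).2 ((hs _).2 ⟨k, rfl⟩))
        exact ⟨i, hf (by rw [hg, hi])⟩
    have hlen : l.length = Fintype.card κ := by
      simpa using Fintype.card_of_bijective hgb
    let α : Equiv.Perm (Fin (Fintype.card κ)) :=
      ((finCongr hlen.symm).trans (Equiv.ofBijective g hgb)).trans e.symm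
    have hα (i) : f (e (α i)) = l.get (i.cast hlen.symm) := by
      simp [α, hg]
    refine ⟨α, Finset.mem_filter.2 ⟨Finset.mem_univ _, fun i j h => ?_⟩, ?_⟩
    · rw [hq, hα, hα] at h
      by_contra hij
      rcases (not_lt.1 hij).eq_or_lt with rfl | hij
      · exact irrefl _ h
      · exact List.pairwise_iff_get.1 hpw _ _ (by simpa using hij) h
    · simp only [hα]
      exact (List.ofFn_congr hlen l.get).symm.trans (List.ofFn_get l)
  · intro α _
    simp only [wordWeight_ofFn, hy]

/-- A word of a poset with an element `z` comparable to all others is a word of the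
elements above `z`, followed by `z`, followed by a word of the elements below `z`. -/
theorem sum_linearWords_separate {ι M : Type*} [AddCommMonoid M]
    {r : ι → ι → Prop} [IsStrictOrder ι r] {s A B : Finset ι} {z : ι}
    (hA : ∀ a ∈ A, r z a) (hB : ∀ b ∈ B, r b z)
    (hs : ∀ a, a ∈ s ↔ a ∈ A ∨ a = z ∨ a ∈ B) (F : List ι → M) :
    ∑ l ∈ linearWords r s, F l =
      ∑ l₁ ∈ linearWords r A, ∑ l₂ ∈ linearWords r B, F (l₁ ++ z :: l₂) := by
  have hzA : z ∉ A := fun h => irrefl _ (hA z h)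
  have hzB : z ∉ B := fun h => irrefl _ (hB z h)
  have hAB : ∀ a ∈ A, a ∉ B := fun a ha hb => irrefl _ (_root_.trans (hB a hb) (hA a ha))
  rw [← Finset.sum_product']
  symm
  refine Finset.sum_bij (fun p _ => p.1 ++ z :: p.2) ?_ ?_ ?_ (fun _ _ => rfl)
  · rintro ⟨l₁, l₂⟩ h
    simp only [Finset.mem_product, mem_linearWords] at h ⊢
    obtain ⟨⟨n₁, m₁, p₁⟩, n₂, m₂, p₂⟩ := h
    refine ⟨?_, ?_, ?_⟩
    · rw [List.nodup_append, List.nodup_cons]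
      refine ⟨n₁, ⟨by rwa [m₂], n₂⟩, ?_⟩
      grind
    · simp [hs, m₁, m₂]
    · rw [List.pairwise_append, List.pairwise_cons]
      refine ⟨p₁, ⟨fun b hb h => asymm h (hB b ((m₂ b).1 hb)), p₂⟩, ?_⟩
      intro a ha b hb h
      have ha := hA a ((m₁ a).1 ha)
      rcases List.mem_cons.1 hb with rfl | hb
      · exact asymm h ha
      · exact asymm h (_root_.trans (hB b ((m₂ b).1 hb)) ha)
  · rintro ⟨l₁, l₂⟩ h ⟨l₁', l₂'⟩ h' heq
    simp only [Finset.mem_product, mem_linearWords] at h h' heq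
    have key (k₁ k₂ : List ι) (m₁ : ∀ a, a ∈ k₁ ↔ a ∈ A) (m₂ : ∀ a, a ∈ k₂ ↔ a ∈ B) :
        (k₁ ++ z :: k₂).filter (· ∈ A) = k₁ ∧ (k₁ ++ z :: k₂).filter (· ∈ B) = k₂ := by
      have f₁ : k₁.filter (· ∈ A) = k₁ := by simp [List.filter_eq_self, m₁]
      have f₂ : k₂.filter (· ∈ B) = k₂ := by simp [List.filter_eq_self, m₂]
      have f₃ : k₁.filter (· ∈ B) = [] := by simpa [List.filter_eq_nil_iff, m₁] using hAB
      have f₄ : k₂.filter (· ∈ A) = [] := by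
        simpa [List.filter_eq_nil_iff, m₂] using fun a hb ha => hAB a ha hb
      simp [List.filter_append, hzA, hzB, f₁, f₂, f₃, f₄]
    obtain ⟨u₁, u₂⟩ := key l₁ l₂ h.1.2.1 h.2.2.1
    obtain ⟨v₁, v₂⟩ := key l₁' l₂' h'.1.2.1 h'.2.2.1
    rw [heq] at u₁ u₂
    exact Prod.ext (u₁.symm.trans v₁) (u₂.symm.trans v₂)
  · intro l hl
    obtain ⟨n, m, p⟩ := mem_linearWords.1 hl
    obtain ⟨l₁, l₂, rfl⟩ := List.append_of_mem ((m z).2 ((hs z).2 (by simp)))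
    simp only [hs, List.mem_append, List.mem_cons] at m
    rw [List.pairwise_append, List.pairwise_cons] at p
    obtain ⟨p₁, ⟨pz, p₂⟩, p₃⟩ := p
    rw [List.nodup_append, List.nodup_cons] at n
    obtain ⟨n₁, ⟨nz, n₂⟩, n₃⟩ := n
    refine ⟨(l₁, l₂), ?_, rfl⟩
    simp only [Finset.mem_product, mem_linearWords]
    refine ⟨⟨n₁, fun a => ?_, p₁⟩, n₂, fun a => ?_, p₂⟩ <;> grind

theorem option_elim_val_injective {ι : Type*} {s : Set ι} {z : ι} (hz : z ∉ s) :
    Function.Injective fun o : Option s => o.elim z Subtype.val := by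
  rintro (_ | a) (_ | b) h
  · rfl
  · exact absurd ((show z = b from h) ▸ b.2) hz
  · exact absurd ((show a = z from h) ▸ a.2) hz
  · exact congrArg some (Subtype.ext h)

/-- If `Z₁ = {z₁}` is a one-element separating subset of a finite
poset `P`, then `G(P) = G(P^≺ ∪ z₁) · G(P^≻ ∪ z₁)`, where `z₁` is adjoined to `P^≺`
as its unique maximum and to `P^≻` as its unique minimum. -/
theorem greeneSum_singleton_separating
    {ι : Type*} [Fintype ι] {K : Type*} [Field K] [CharZero K]
    (r : ι → ι → Prop) (hr : IsStrictOrder ι r)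
    (x : ι → K) (hx : Function.Injective x)
    (z₁ : ι) (hsep : IsSeparating r {z₁}) :
    greeneSum r x =
      greeneSum (adjoinMax (fun a b : ↥(below r {z₁}) => r a.1 b.1))
          (extendVar (fun a : ↥(below r {z₁}) => x a.1) (x z₁)) *
        greeneSum (adjoinMin (fun a b : ↥(above r {z₁}) => r a.1 b.1))
          (extendVar (fun a : ↥(above r {z₁}) => x a.1) (x z₁)) := by
  have hsplit (a : ι) : r z₁ a ∨ a = z₁ ∨ r a z₁ := by
    by_cases h : a = z₁
    · exact Or.inr (Or.inl h)
    · have := hsep.2 a h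
      simp only [Set.mem_singleton_iff, forall_eq] at this
      tauto
  let A : Finset ι := Finset.univ.filter (r z₁)
  let B : Finset ι := Finset.univ.filter (r · z₁)
  have hA : ∀ a ∈ A, r z₁ a := by simp [A]
  have hB : ∀ b ∈ B, r b z₁ := by simp [B]
  rw [greeneSum_eq_sum_linearWords (r := r) (x := x) (s := Finset.univ) id
      Function.injective_id (by simp) (by simp) (by simp),
    greeneSum_eq_sum_linearWords (r := r) (x := x) (s := insert z₁ B)
      (fun o => o.elim z₁ Subtype.val) ?_ ?_ ?_ ?_,
    greeneSum_eq_sum_linearWords (r := r) (x := x) (s := insert z₁ A)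
      (fun o => o.elim z₁ Subtype.val) ?_ ?_ ?_ ?_,
    sum_linearWords_separate hA hB (by simpa [A, B] using hsplit),
    sum_linearWords_separate (s := insert z₁ B) (A := ∅) (z := z₁) (by simp) hB (by simp),
    sum_linearWords_separate (s := insert z₁ A) (B := ∅) (z := z₁) hA (by simp) (by simp [or_comm])]
  · simp only [linearWords_empty, Finset.sum_singleton, List.nil_append]
    rw [mul_comm, Finset.sum_mul_sum]
    simp only [← wordWeight_append_cons]
  · exact option_elim_val_injective fun h => irrefl _ (h z₁ rfl)
  · simp [A, above, Option.exists, eq_comm]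
  · rintro (_ | a) (_ | b)
    · simpa [adjoinMin] using irrefl (r := r) z₁
    · simpa [adjoinMin] using b.2 z₁ rfl
    · simpa [adjoinMin] using asymm (a.2 z₁ rfl)
    · simp [adjoinMin]
  · rintro (_ | a) <;> rfl
  · exact option_elim_val_injective fun h => irrefl _ (h z₁ rfl)
  · simp [B, below, Option.exists, eq_comm]
  · rintro (_ | a) (_ | b)
    · simpa [adjoinMax] using irrefl (r := r) z₁
    · simpa [adjoinMax] using asymm (b.2 z₁ rfl)
    · simpa [adjoinMax] using a.2 z₁ rfl
    · simp [adjoinMax]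
  · rintro (_ | a) <;> rfl

end
end

section
/- Let Z_k = {z_1,…,z_k} be a separating subset of a finite poset P with P^≺ = ∅. Then G(P) = Δ_{Z_k}[G(P^≻ ∪ z)] = Σ_{j=1}^k G(P^≻ ∪ z_j)/h′(z_j), where h(z) = ∏_{i=1}^k (z − z_i) and G(P^≻ ∪ z_j) is the Greene sum of the poset P^≻ with z_j adjoined as its unique minimum. -/
open scoped Classical

noncomputable section

/-- The product of the inverses of consecutive differences along a list. -/
def chainWeight {K : Type*} [Field K] : List K → K
  | a :: b :: l => (a - b)⁻¹ * chainWeight (b :: l)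
  | _ => 1

theorem chainWeight_append_cons {K : Type*} [Field K] (u : List K) (a : K) (v : List K) :
    chainWeight (u ++ a :: v) = chainWeight (u ++ [a]) * chainWeight (a :: v) := by
  induction u with
  | nil => simp [chainWeight]
  | cons b u ih =>
    cases u with
    | nil => simp [chainWeight]
    | cons c u =>
      simp only [List.cons_append, chainWeight] at ih ⊢
      rw [ih, mul_assoc]

theorem chainWeight_ofFn {K : Type*} [Field K] {n : ℕ} (f : Fin n → K) :
    chainWeight (List.ofFn f) = ∏ m : Fin (n - 1), (f (idxLo m) - f (idxHi m))⁻¹ := by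
  induction n with
  | zero => simp [chainWeight]
  | succ n ih =>
    cases n with
    | zero => simp [chainWeight]
    | succ n =>
      have h := ih (fun i => f i.succ)
      rw [List.ofFn_succ] at h
      rw [List.ofFn_succ, List.ofFn_succ, chainWeight, h]
      exact (Fin.prod_univ_succ
        (fun m : Fin (n + 1) => (f (idxLo (n := n + 2) m) - f (idxHi (n := n + 2) m))⁻¹)).symm

/-- All lists enumerating `S` without repetition. -/
def Finset.orderings {ι : Type*} (S : Finset ι) : Finset (List ι) :=
  ⟨S.val.lists, Multiset.lists_nodup_finset S⟩

/-- The linear extensions of `(ι, r)`, written as lists from maximal to minimal elements. -/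
def linExts {ι : Type*} [Fintype ι] (r : ι → ι → Prop) : Finset (List ι) :=
  (Finset.univ : Finset ι).orderings.filter (List.Pairwise fun a b => ¬ r a b)

theorem Finset.mem_orderings {ι : Type*} {S : Finset ι} {l : List ι} :
    l ∈ S.orderings ↔ l.Nodup ∧ ∀ a, a ∈ l ↔ a ∈ S := by
  rw [← Finset.mem_val, Finset.orderings, Multiset.mem_lists_iff]
  constructor
  · intro h
    refine ⟨?_, fun a => ?_⟩
    · have := S.nodup
      rw [h] at this
      exact this
    · rw [← Finset.mem_val, h]
      rfl
  · rintro ⟨h, h'⟩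
    refine (Multiset.Nodup.ext S.nodup (t := (l : Multiset ι)) (by exact h)).2 fun a => ?_
    simp [h']

theorem mem_linExts {ι : Type*} [Fintype ι] {r : ι → ι → Prop} {l : List ι} :
    l ∈ linExts r ↔ l.Nodup ∧ (∀ a, a ∈ l) ∧ l.Pairwise fun a b => ¬ r a b := by
  simp [linExts, Finset.mem_orderings, and_assoc]

theorem greeneSum_eq_sum_linExts {ι : Type*} [Fintype ι] {K : Type*} [Field K]
    (r : ι → ι → Prop) (hr : ∀ a, ¬ r a a) (x : ι → K) :
    greeneSum r x = ∑ l ∈ linExts r, chainWeight (l.map x) := by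
  rw [greeneSum, ← Finset.sum_filter]
  refine Finset.sum_bij
    (fun α _ => List.ofFn fun i => (Fintype.equivFin ι).symm (α i)) ?_ ?_ ?_ ?_
  · intro α hα
    rw [Finset.mem_filter] at hα
    refine mem_linExts.2 ⟨?_, fun a => ?_, ?_⟩
    · exact List.nodup_ofFn.2 ((Fintype.equivFin ι).symm.injective.comp α.injective)
    · exact (List.mem_ofFn' _ _).2 ⟨α.symm (Fintype.equivFin ι a), by simp⟩
    · refine List.pairwise_ofFn.2 fun i j hij h => ?_
      exact lt_asymm hij (hα.2 i j h)
  · intro α _ β _ h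
    ext i : 1
    exact (Fintype.equivFin ι).symm.injective (congrFun (List.ofFn_injective h) i)
  · intro l hl
    obtain ⟨hnd, hmem, hpw⟩ := mem_linExts.1 hl
    have hlen : l.length = Fintype.card ι := by
      rw [← List.toFinset_card_of_nodup hnd, ← Finset.card_univ]
      congr 1
      ext a
      simp [hmem]
    have hget : List.ofFn (fun i : Fin (Fintype.card ι) => l.get (i.cast hlen.symm)) = l := by
      refine List.ext_get (by simp [hlen]) fun n h₁ h₂ => ?_
      simp
    have hinj : Function.Injective fun i : Fin (Fintype.card ι) =>
        Fintype.equivFin ι (l.get (i.cast hlen.symm)) := by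
      intro i j h
      have := List.nodup_iff_injective_get.1 hnd ((Fintype.equivFin ι).injective h)
      simpa using this
    refine ⟨Equiv.ofBijective _ (Finite.injective_iff_bijective.1 hinj), ?_, by simpa using hget⟩
    rw [Finset.mem_filter]
    refine ⟨Finset.mem_univ _, fun i j h => ?_⟩
    simp only [Equiv.ofBijective_apply, Equiv.symm_apply_apply] at h
    rw [← hget, List.pairwise_ofFn] at hpw
    rcases lt_trichotomy i j with hij | rfl | hij
    · exact absurd h (hpw hij)
    · exact absurd h (hr _)
    · exact hij
  · intro α _
    rw [List.map_ofFn, chainWeight_ofFn]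
    rfl

theorem List.map_append_map_inj {α β ι : Type*} {f : α → ι} {g : β → ι}
    (hf : Function.Injective f) (hg : Function.Injective g) (hfg : ∀ a b, f a ≠ g b)
    {w w' : List α} {s s' : List β} (h : w.map f ++ s.map g = w'.map f ++ s'.map g) :
    w = w' ∧ s = s' := by
  induction w generalizing w' with
  | nil =>
    cases w' with
    | nil => exact ⟨rfl, hg.list_map (by simpa using h)⟩
    | cons a w' =>
      cases s with
      | nil => simp at h
      | cons b s => exact absurd (by simpa using (List.cons.inj h).1.symm) (hfg a b)
  | cons a w ih =>
    cases w' with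
    | nil =>
      cases s' with
      | nil => simp at h
      | cons b s' => exact absurd (by simpa using (List.cons.inj h).1) (hfg a b)
    | cons a' w' =>
      obtain ⟨h₁, h₂⟩ := List.cons.inj h
      obtain ⟨rfl, rfl⟩ := ih h₂
      exact ⟨by rw [hf h₁], rfl⟩

theorem List.exists_eq_map_append_map {α β ι : Type*} {f : α → ι} {g : β → ι}
    (hfg : ∀ c, c ∈ Set.range f ∨ c ∈ Set.range g) {l : List ι}
    (hl : l.Pairwise fun c d => ¬ (c ∈ Set.range g ∧ d ∈ Set.range f)) :
    ∃ w s, l = List.map f w ++ List.map g s := by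
  induction l with
  | nil => exact ⟨[], [], rfl⟩
  | cons c l ih =>
    obtain ⟨hc, hl'⟩ := List.pairwise_cons.1 hl
    rcases hfg c with ⟨a, rfl⟩ | ⟨b, rfl⟩
    · obtain ⟨w, s, rfl⟩ := ih hl'
      exact ⟨a :: w, s, rfl⟩
    · have : ∀ d ∈ l, d ∈ Set.range g := fun d hd =>
        (hfg d).resolve_left fun h => hc d hd ⟨⟨b, rfl⟩, h⟩
      obtain ⟨s, rfl⟩ : ∃ s, List.map g s = l := by
        rwa [← Set.mem_range, Set.range_list_map]
      exact ⟨[], b :: s, rfl⟩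

/-- Linear extensions of an ordinal sum are concatenations of linear extensions of the summands. -/
theorem sum_linExts_ordinalSum {α β ι M : Type*} [Fintype α] [Fintype β] [Fintype ι]
    [AddCommMonoid M] {f : α → ι} {g : β → ι}
    (hf : Function.Injective f) (hg : Function.Injective g) (hfg : ∀ a b, f a ≠ g b)
    (hcover : ∀ c, c ∈ Set.range f ∨ c ∈ Set.range g)
    {r : ι → ι → Prop} (hgf : ∀ a b, r (g b) (f a)) (hfg' : ∀ a b, ¬ r (f a) (g b))
    (H : List ι → M) :
    ∑ l ∈ linExts r, H l =
      ∑ w ∈ linExts (fun a b => r (f a) (f b)), ∑ s ∈ linExts (fun a b => r (g a) (g b)),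
        H (w.map f ++ s.map g) := by
  have key (w : List α) (s : List β) : w.map f ++ s.map g ∈ linExts r ↔
      w ∈ linExts (fun a b => r (f a) (f b)) ∧ s ∈ linExts (fun a b => r (g a) (g b)) := by
    have hmem : (∀ c, c ∈ w.map f ++ s.map g) ↔ (∀ a, a ∈ w) ∧ ∀ b, b ∈ s := by
      constructor
      · refine fun h => ⟨fun a => ?_, fun b => ?_⟩
        · rcases List.mem_append.1 (h (f a)) with h | h
          · exact (List.mem_map_of_injective hf).1 h
          · obtain ⟨b, -, hb⟩ := List.mem_map.1 h
            exact absurd hb.symm (hfg a b)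
        · rcases List.mem_append.1 (h (g b)) with h | h
          · obtain ⟨a, -, ha⟩ := List.mem_map.1 h
            exact absurd ha (hfg a b)
          · exact (List.mem_map_of_injective hg).1 h
      · rintro ⟨h₁, h₂⟩ c
        rcases hcover c with ⟨a, rfl⟩ | ⟨b, rfl⟩
        · exact List.mem_append_left _ (List.mem_map_of_mem (h₁ a))
        · exact List.mem_append_right _ (List.mem_map_of_mem (h₂ b))
    have hnd : (w.map f ++ s.map g).Nodup ↔ w.Nodup ∧ s.Nodup := by
      rw [List.nodup_append, List.nodup_map_iff hf, List.nodup_map_iff hg]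
      simp only [List.mem_map]
      constructor
      · exact fun h => ⟨h.1, h.2.1⟩
      · refine fun h => ⟨h.1, h.2, ?_⟩
        rintro _ ⟨a, -, rfl⟩ _ ⟨b, -, rfl⟩
        exact hfg a b
    have hpw : (w.map f ++ s.map g).Pairwise (fun a b => ¬ r a b) ↔
        w.Pairwise (fun a b => ¬ r (f a) (f b)) ∧ s.Pairwise (fun a b => ¬ r (g a) (g b)) := by
      rw [List.pairwise_append, List.pairwise_map, List.pairwise_map]
      simp only [List.mem_map]
      constructor
      · exact fun h => ⟨h.1, h.2.1⟩
      · refine fun h => ⟨h.1, h.2, ?_⟩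
        rintro _ ⟨a, -, rfl⟩ _ ⟨b, -, rfl⟩
        exact hfg' a b
    rw [mem_linExts, mem_linExts, mem_linExts, hmem, hnd, hpw]
    tauto
  rw [← Finset.sum_product']
  symm
  refine Finset.sum_bij (fun p _ => p.1.map f ++ p.2.map g) ?_ ?_ ?_ fun _ _ => rfl
  · exact fun p hp => (key _ _).2 (Finset.mem_product.1 hp)
  · intro p _ q _ h
    exact Prod.ext_iff.2 (List.map_append_map_inj hf hg hfg h)
  · intro l hl
    obtain ⟨w, s, rfl⟩ := List.exists_eq_map_append_map hcover (l := l) (by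
      refine (mem_linExts.1 hl).2.2.imp ?_
      rintro _ _ h ⟨⟨b, rfl⟩, ⟨a, rfl⟩⟩
      exact h (hgf a b))
    exact ⟨(w, s), Finset.mem_product.2 ((key _ _).1 hl), rfl⟩

theorem Finset.sum_orderings_eq_sum_cons {ι M : Type*} [DecidableEq ι] [AddCommMonoid M]
    {S : Finset ι} (hS : S.Nonempty) (H : List ι → M) :
    ∑ l ∈ S.orderings, H l = ∑ j ∈ S, ∑ t ∈ (S.erase j).orderings, H (j :: t) := by
  rw [Finset.sum_sigma']
  symm
  refine Finset.sum_bij (fun p _ => p.1 :: p.2) ?_ ?_ ?_ fun _ _ => rfl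
  · rintro ⟨j, t⟩ h
    simp only [Finset.mem_sigma, Finset.mem_orderings, Finset.mem_erase, List.nodup_cons,
      List.mem_cons] at h ⊢
    obtain ⟨hj, hnd, ht⟩ := h
    refine ⟨⟨by simp [ht], hnd⟩, fun a => ?_⟩
    rw [ht]
    by_cases ha : a = j <;> simp [ha, hj]
  · rintro ⟨j, t⟩ _ ⟨j', t'⟩ _ h
    obtain ⟨rfl, rfl⟩ := List.cons.inj h
    rfl
  · intro l hl
    cases l with
    | nil =>
      obtain ⟨a, ha⟩ := hS
      simpa using ((Finset.mem_orderings.1 hl).2 a).2 ha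
    | cons j t =>
      refine ⟨⟨j, t⟩, ?_, rfl⟩
      simp only [Finset.mem_sigma, Finset.mem_orderings, Finset.mem_erase, List.nodup_cons,
        List.mem_cons] at hl ⊢
      obtain ⟨⟨hjt, hnd⟩, h⟩ := hl
      refine ⟨(h j).1 (Or.inl rfl), hnd, fun a => ⟨fun ha => ⟨?_, (h a).1 (Or.inr ha)⟩, ?_⟩⟩
      · rintro rfl
        exact hjt ha
      · exact fun ha => ((h a).2 ha.2).resolve_left ha.1

theorem sum_inv_sub_mul_prod_erase {ι K : Type*} [DecidableEq ι] [Field K] {y : ι → K}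
    {S : Finset ι} (hS : S.Nonempty) (hy : Set.InjOn y S) {c : K} (hc : ∀ i ∈ S, c ≠ y i) :
    ∑ i ∈ S, (c - y i)⁻¹ * ∏ l ∈ S.erase i, (y i - y l)⁻¹ = ∏ i ∈ S, (c - y i)⁻¹ := by
  have h := Lagrange.eval_interpolate_not_at_node (r := (1 : ι → K)) hc
  rw [Lagrange.interpolate_one hy hS, Polynomial.eval_one, Lagrange.eval_nodal] at h
  rw [Finset.prod_inv_distrib]
  refine eq_inv_of_mul_eq_one_right (Eq.trans ?_ h.symm)
  congr 1
  refine Finset.sum_congr rfl fun i _ => ?_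
  simp [Lagrange.nodalWeight, mul_comm]

/-- The chain weights of all words starting with `j` and then listing `S` add up to the
weight of the star with centre `j` and leaves `S`. -/
theorem sum_chainWeight_cons {ι K : Type*} [DecidableEq ι] [Field K] {y : ι → K}
    (hy : Function.Injective y) (S : Finset ι) (j : ι) (hj : j ∉ S) :
    ∑ t ∈ S.orderings, chainWeight (y j :: t.map y) = ∏ i ∈ S, (y j - y i)⁻¹ := by
  induction S using Finset.strongInduction generalizing j with
  | H S ih =>
    rcases S.eq_empty_or_nonempty with rfl | hS
    · have : (∅ : Finset ι).orderings = {[]} := by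
        ext l
        rw [Finset.mem_orderings, Finset.mem_singleton]
        constructor
        · exact fun h => List.eq_nil_iff_forall_not_mem.2 fun a ha => by simpa using (h.2 a).1 ha
        · rintro rfl
          simp
      simp [this, chainWeight]
    · rw [Finset.sum_orderings_eq_sum_cons hS, ← sum_inv_sub_mul_prod_erase hS hy.injOn
        (c := y j) fun i hi h => hj (by rwa [hy h])]
      refine Finset.sum_congr rfl fun i hi => ?_
      rw [← ih _ (Finset.erase_ssubset hi) i (Finset.notMem_erase i S), Finset.mul_sum]
      rfl

theorem linExts_eq_orderings {ι : Type*} [Fintype ι] {r : ι → ι → Prop}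
    (h : ∀ a b, ¬ r a b) :
    linExts r = (Finset.univ : Finset ι).orderings := by
  ext l
  rw [mem_linExts, Finset.mem_orderings]
  have : l.Pairwise fun a b => ¬ r a b := List.pairwise_of_forall h
  simp [this]

theorem greeneSum_adjoinMin {ι K : Type*} [Fintype ι] [Field K] {r : ι → ι → Prop}
    (hr : ∀ a, ¬ r a a) (x : ι → K) (c : K) :
    greeneSum (adjoinMin r) (extendVar x c) =
      ∑ w ∈ linExts r, chainWeight (w.map x ++ [c]) := by
  have hirr : ∀ a, ¬ adjoinMin r a a := by
    rintro (_ | a)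
    · exact id
    · exact hr a
  have hunit : linExts (fun _ _ : Unit => adjoinMin r none none) = {[()]} := by
    ext l
    rw [mem_linExts, Finset.mem_singleton]
    constructor
    · rintro ⟨h, h', -⟩
      match l, h, h' with
      | [], _, h' => simpa using h' ()
      | [_], _, _ => rfl
      | _ :: _ :: _, h, _ => simp at h
    · rintro rfl
      simp
  rw [greeneSum_eq_sum_linExts _ hirr, sum_linExts_ordinalSum (f := some) (g := fun _ : Unit => none)
    (Option.some_injective ι) (fun _ _ _ => rfl) (fun _ _ => Option.some_ne_none _)
    (fun c => by cases c <;> simp) (fun _ _ => trivial) (fun _ _ => id), hunit]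
  refine Finset.sum_congr rfl fun w _ => ?_
  rw [Finset.sum_singleton, List.map_append, List.map_map]
  rfl

/-- If `Z_k` is a separating subset of `P` with `P^≺ = ∅`, then
`G(P) = Δ_{Z_k}[G(P^≻ ∪ z)] = Σ_j G(P^≻ ∪ z_j)/h'(z_j)`. -/
theorem greeneSum_separating_below_empty
    {ι : Type*} [Fintype ι] {K : Type*} [Field K] [CharZero K]
    (r : ι → ι → Prop) (hr : IsStrictOrder ι r)
    (x : ι → K) (hx : Function.Injective x)
    {k : ℕ} (hk : 0 < k) (z : Fin k → ι) (hz : Function.Injective z)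
    (hsep : IsSeparating r (Set.range z))
    (hprec : below r (Set.range z) = ∅) :
    greeneSum r x =
      dividedDiff (fun j => x (z j))
        (fun w => greeneSum (adjoinMin (fun a b : ↥(above r (Set.range z)) => r a.1 b.1))
          (extendVar (fun a : ↥(above r (Set.range z)) => x a.1) w)) ∧
    greeneSum r x =
      ∑ j : Fin k,
        greeneSum (adjoinMin (fun a b : ↥(above r (Set.range z)) => r a.1 b.1))
            (extendVar (fun a : ↥(above r (Set.range z)) => x a.1) (x (z j))) *
          (∏ i ∈ Finset.univ.erase j, (x (z j) - x (z i)))⁻¹ := by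
  have hirr : ∀ a, ¬ r a a := hr.toIrrefl.irrefl
  have hasymm : ∀ a b, r a b → ¬ r b a := fun a b h h' => hirr a (hr.toIsTrans.trans _ _ _ h h')
  have hdisj : ∀ (a : ↥(above r (Set.range z))) b, a.1 ≠ z b := fun a b h =>
    hirr (z b) (h ▸ a.2 (z b) ⟨b, rfl⟩)
  have hcover : ∀ c, c ∈ Set.range (Subtype.val : ↥(above r (Set.range z)) → ι) ∨
      c ∈ Set.range z := by
    intro c
    by_contra! h
    rcases hsep.2 c h.2 with h' | h'
    · exact (Set.eq_empty_iff_forall_notMem.1 hprec) c h'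
    · exact h.1 ⟨⟨c, h'⟩, rfl⟩
  have hanti : ∀ a b, ¬ r (z a) (z b) := by
    intro a b
    by_cases hab : z a = z b
    · rw [hab]
      exact hirr _
    · exact (hsep.1 _ ⟨a, rfl⟩ _ ⟨b, rfl⟩ hab).1
  have hne : (Finset.univ : Finset (Fin k)).Nonempty := ⟨⟨0, hk⟩, Finset.mem_univ _⟩
  have hgf : ∀ (a : ↥(above r (Set.range z))) b, r (z b) a.1 := fun a b => a.2 _ ⟨b, rfl⟩
  rw [dividedDiff, and_self, greeneSum_eq_sum_linExts r hirr,
    sum_linExts_ordinalSum Subtype.val_injective hz hdisj hcover hgf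
      (fun a b => hasymm _ _ (hgf a b)),
    linExts_eq_orderings hanti]
  simp_rw [greeneSum_adjoinMin (r := fun a b : ↥(above r (Set.range z)) => r a.1 b.1)
    (fun a => hirr a.1)]
  simp_rw [Finset.sum_mul]
  rw [Finset.sum_comm (s := Finset.univ)]
  refine Finset.sum_congr rfl fun w _ => ?_
  rw [Finset.sum_orderings_eq_sum_cons hne]
  refine Finset.sum_congr rfl fun j _ => ?_
  rw [← Finset.prod_inv_distrib,
    ← sum_chainWeight_cons (y := fun j => x (z j)) (hx.comp hz) _ j (Finset.notMem_erase j _),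
    Finset.mul_sum]
  refine Finset.sum_congr rfl fun t _ => ?_
  rw [← chainWeight_append_cons, List.map_append, List.map_map, List.map_map]
  rfl
end
end

section
/- Let Z_k = {z_1,…,z_k} be a separating subset of a finite poset P. For i ∈ {1,…,k} let P_{i≺} be P with the added relations z_i ≺ z_j for all j ≠ i, let P_{j≻} be P with the added relations z_j ≻ z_i for all i ≠ j, and for i ≠ j let P_{i≺,j≻} be P with the added relations z_i ≺ z_l and z_j ≻ z_l for all l ∉ {i,j} (together with z_i ≺ z_j). Then L(P) is the disjoint union of the sets L(P_{i≺}) over i, also the disjoint union of the sets L(P_{j≻}) over j, and (for k > 1) the disjoint union of the sets L(P_{i≺,j≻}) over ordered pairs i ≠ j; consequently G(P) = Σ_i G(P_{i≺}) = Σ_j G(P_{j≻}) = Σ_{i≠j} G(P_{i≺,j≻}). -/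
open scoped Classical

noncomputable section

/-- `l` is a linear extension of the induced subposet of `(ι, r)` on `S`, written as a
word listing the elements of `S` from maximal to minimal: `l` has no repetitions, its
members are exactly the elements of `S`, and no element is `≺`-below a later element. -/
def IsLinExtOn {ι : Type*} (r : ι → ι → Prop) (S : Set ι) (l : List ι) : Prop :=
  l.Nodup ∧ (∀ a, a ∈ l ↔ a ∈ S) ∧ l.Pairwise (fun a b => ¬ r a b)

/-- `f` is strictly order-reversing from `r` to the natural numbers; for the position function
of a word, this says that the word lists larger elements first. -/
def StrictlyReverses {ι : Type*} (r : ι → ι → Prop) (f : ι → ℕ) : Prop :=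
  ∀ a b, r a b → f b < f a

theorem strictlyReverses_transGen {ι : Type*} {s : ι → ι → Prop} {f : ι → ℕ} :
    StrictlyReverses (Relation.TransGen s) f ↔ StrictlyReverses s f := by
  refine ⟨fun h a b hab => h a b (.single hab), fun h a b hab => ?_⟩
  induction hab with
  | single hab => exact h _ _ hab
  | tail _ hbc ih => exact (h _ _ hbc).trans ih

theorem isLinExtOn_univ_transGen_iff {ι : Type*} {s : ι → ι → Prop} (hs : ∀ a, ¬ s a a)
    (l : List ι) :
    IsLinExtOn (Relation.TransGen s) Set.univ l ↔
      l.Nodup ∧ (∀ a, a ∈ l) ∧ StrictlyReverses s (fun a => l.idxOf a) := by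
  simp only [IsLinExtOn, Set.mem_univ, iff_true]
  refine and_congr_right fun hnodup => and_congr_right fun hmem =>
    ⟨fun h a b hab => ?_, fun h => ?_⟩
  · have ha := List.idxOf_lt_length_of_mem (hmem a)
    have hb := List.idxOf_lt_length_of_mem (hmem b)
    by_contra! hle
    rcases hle.lt_or_eq with hlt | heq
    · have := List.pairwise_iff_getElem.1 h _ _ ha hb hlt
      simp only [List.getElem_idxOf] at this
      exact this (.single hab)
    · obtain rfl := (List.idxOf_inj (hmem a)).1 heq
      exact hs a hab
  · rw [List.pairwise_iff_getElem]
    intro i j hi hj hij hr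
    have := strictlyReverses_transGen.2 h _ _ hr
    simp only [hnodup.idxOf_getElem] at this
    omega

theorem greeneSum_eq_sum_strictlyReverses {ι : Type*} [Fintype ι] {K : Type*} [Field K]
    (r : ι → ι → Prop) (x : ι → K) :
    greeneSum r x = ∑ α : Equiv.Perm (Fin (Fintype.card ι)),
      if StrictlyReverses r (fun a => (α.symm (Fintype.equivFin ι a)).1) then
        ∏ m : Fin (Fintype.card ι - 1),
          (x ((Fintype.equivFin ι).symm (α (idxLo m))) -
            x ((Fintype.equivFin ι).symm (α (idxHi m))))⁻¹
      else 0 := by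
  refine Finset.sum_congr rfl fun α _ =>
    if_congr ⟨fun h a b hab => ?_, fun h i j hij => ?_⟩ rfl rfl
  · exact h _ _ (by simpa using hab)
  · simpa using h _ _ hij

/-- If every order-reversing injection for `r` reverses exactly one of the relations `g p`,
`p ∈ S`, then the linear extensions of the transitive closures of the `g p` partition
those of `r`, and the Greene sums add up. -/
theorem linExt_partition_of_strictlyReverses {ι : Type*} [Fintype ι] {K : Type*} [Field K]
    {r : ι → ι → Prop} (hr : IsStrictOrder ι r) (x : ι → K)
    {κ : Type*} (S : Finset κ) (g : κ → ι → ι → Prop)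
    (hirrefl : ∀ p ∈ S, ∀ a, ¬ g p a a)
    (hcover : ∀ f : ι → ℕ, f.Injective →
      (StrictlyReverses r f ↔ ∃ p ∈ S, StrictlyReverses (g p) f))
    (hunique : ∀ f : ι → ℕ, ∀ p ∈ S, ∀ q ∈ S,
      StrictlyReverses (g p) f → StrictlyReverses (g q) f → p = q) :
    ({l | IsLinExtOn r Set.univ l} =
      ⋃ p ∈ S, {l | IsLinExtOn (Relation.TransGen (g p)) Set.univ l}) ∧
    (∀ p ∈ S, ∀ q ∈ S, p ≠ q →
      Disjoint {l | IsLinExtOn (Relation.TransGen (g p)) Set.univ l}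
        {l | IsLinExtOn (Relation.TransGen (g q)) Set.univ l}) ∧
    greeneSum r x = ∑ p ∈ S, greeneSum (Relation.TransGen (g p)) x := by
  refine ⟨?_, fun p hp q hq hpq => ?_, ?_⟩
  · ext l
    have hlin := isLinExtOn_univ_transGen_iff hr.irrefl l
    rw [Relation.transGen_eq_self] at hlin
    simp only [Set.mem_ofPred_eq, Set.mem_iUnion, exists_prop, hlin]
    constructor
    · rintro ⟨hnodup, hmem, h⟩
      obtain ⟨p, hp, hg⟩ := (hcover _ fun a b hab => (List.idxOf_inj (hmem a)).1 hab).1 h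
      exact ⟨p, hp, (isLinExtOn_univ_transGen_iff (hirrefl p hp) l).2 ⟨hnodup, hmem, hg⟩⟩
    · rintro ⟨p, hp, h⟩
      obtain ⟨hnodup, hmem, hg⟩ := (isLinExtOn_univ_transGen_iff (hirrefl p hp) l).1 h
      exact ⟨hnodup, hmem,
        (hcover _ fun a b hab => (List.idxOf_inj (hmem a)).1 hab).2 ⟨p, hp, hg⟩⟩
  · rw [Set.disjoint_left]
    intro l hlp hlq
    exact hpq (hunique _ p hp q hq
      ((isLinExtOn_univ_transGen_iff (hirrefl p hp) l).1 hlp).2.2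
      ((isLinExtOn_univ_transGen_iff (hirrefl q hq) l).1 hlq).2.2)
  · simp only [greeneSum_eq_sum_strictlyReverses, strictlyReverses_transGen]
    rw [Finset.sum_comm]
    refine Finset.sum_congr rfl fun α _ => ?_
    have hinj : Function.Injective fun a => (α.symm (Fintype.equivFin ι a)).1 :=
      Fin.val_injective.comp (α.symm.injective.comp (Fintype.equivFin ι).injective)
    by_cases h : StrictlyReverses r fun a => (α.symm (Fintype.equivFin ι a)).1
    · obtain ⟨p, hp, hg⟩ := (hcover _ hinj).1 h
      rw [if_pos h, Finset.sum_eq_single_of_mem p hp, if_pos hg]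
      exact fun q hq hqp => if_neg fun hgq => hqp (hunique _ q hq p hp hgq hg)
    · rw [if_neg h, Finset.sum_eq_zero]
      exact fun p hp => if_neg fun hg => h ((hcover _ hinj).2 ⟨p, hp, hg⟩)

theorem strictlyReverses_or {ι : Type*} {r s : ι → ι → Prop} {f : ι → ℕ} :
    StrictlyReverses (fun a b => r a b ∨ s a b) f ↔
      StrictlyReverses r f ∧ StrictlyReverses s f := by
  simp only [StrictlyReverses, or_imp, forall_and]

theorem strictlyReverses_fst {ι κ : Type*} {z : κ → ι} {i : κ} {f : ι → ℕ} :
    StrictlyReverses (fun a b => a = z i ∧ ∃ j, j ≠ i ∧ b = z j) f ↔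
      ∀ j, j ≠ i → f (z j) < f (z i) := by
  constructor
  · exact fun h j hj => h _ _ ⟨rfl, j, hj, rfl⟩
  · rintro h _ _ ⟨rfl, j, hj, rfl⟩
    exact h j hj

theorem strictlyReverses_snd {ι κ : Type*} {z : κ → ι} {j : κ} {f : ι → ℕ} :
    StrictlyReverses (fun a b => b = z j ∧ ∃ i, i ≠ j ∧ a = z i) f ↔
      ∀ i, i ≠ j → f (z j) < f (z i) := by
  constructor
  · exact fun h i hi => h _ _ ⟨rfl, i, hi, rfl⟩
  · rintro h _ _ ⟨rfl, i, hi, rfl⟩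
    exact h i hi

theorem exists_forall_ne_lt_of_injective {κ : Type*} [Finite κ] [Nonempty κ] {f : κ → ℕ}
    (hf : f.Injective) : ∃ i, ∀ j, j ≠ i → f j < f i := by
  obtain ⟨i, hi⟩ := Finite.exists_max f
  exact ⟨i, fun j hj => (hi j).lt_of_ne (hf.ne hj)⟩

theorem exists_forall_ne_gt_of_injective {κ : Type*} [Finite κ] [Nonempty κ] {f : κ → ℕ}
    (hf : f.Injective) : ∃ j, ∀ i, i ≠ j → f j < f i := by
  obtain ⟨j, hj⟩ := Finite.exists_min f
  exact ⟨j, fun i hi => (hj i).lt_of_ne (hf.ne hi.symm)⟩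

theorem eq_of_forall_ne_lt {κ : Type*} {f : κ → ℕ} {i j : κ}
    (hi : ∀ l, l ≠ i → f l < f i) (hj : ∀ l, l ≠ j → f l < f j) : i = j := by
  by_contra h
  exact (hi j (Ne.symm h)).asymm (hj i h)

theorem eq_of_forall_ne_gt {κ : Type*} {f : κ → ℕ} {i j : κ}
    (hi : ∀ l, l ≠ i → f i < f l) (hj : ∀ l, l ≠ j → f j < f l) : i = j := by
  by_contra h
  exact (hi j (Ne.symm h)).asymm (hj i h)

/-- For a separating subset `Z_k` of `P`, the linear extensions of `P`
are partitioned by the posets `P_{i≺}` (with added relations `z_i ≺ z_j`, `j ≠ i`),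
also by the posets `P_{j≻}` (with added relations `z_j ≻ z_i`, `i ≠ j`), and (for
`k > 1`) by the posets `P_{i≺,j≻}`; consequently
`G(P) = Σ_i G(P_{i≺}) = Σ_j G(P_{j≻}) = Σ_{i≠j} G(P_{i≺,j≻})`. -/
theorem linExt_partition_added_relations
    {ι : Type*} [Fintype ι] {K : Type*} [Field K] [CharZero K]
    (r : ι → ι → Prop) (hr : IsStrictOrder ι r)
    (x : ι → K) (hx : Function.Injective x)
    {k : ℕ} (hk : 0 < k) (z : Fin k → ι) (hz : Function.Injective z)
    (hsep : IsSeparating r (Set.range z))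
    (rp rs : Fin k → ι → ι → Prop) (rps : Fin k → Fin k → ι → ι → Prop)
    (hrp : ∀ i, rp i = Relation.TransGen
      (fun a b => r a b ∨ (a = z i ∧ ∃ j, j ≠ i ∧ b = z j)))
    (hrs : ∀ j, rs j = Relation.TransGen
      (fun a b => r a b ∨ (b = z j ∧ ∃ i, i ≠ j ∧ a = z i)))
    (hrps : ∀ i j, rps i j = Relation.TransGen
      (fun a b => r a b ∨ (a = z i ∧ ∃ l, l ≠ i ∧ b = z l) ∨
        (b = z j ∧ ∃ l, l ≠ j ∧ a = z l))) :
    ({l | IsLinExtOn r Set.univ l} = ⋃ i, {l | IsLinExtOn (rp i) Set.univ l}) ∧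
    (∀ i i', i ≠ i' →
      Disjoint {l | IsLinExtOn (rp i) Set.univ l} {l | IsLinExtOn (rp i') Set.univ l}) ∧
    ({l | IsLinExtOn r Set.univ l} = ⋃ j, {l | IsLinExtOn (rs j) Set.univ l}) ∧
    (∀ j j', j ≠ j' →
      Disjoint {l | IsLinExtOn (rs j) Set.univ l} {l | IsLinExtOn (rs j') Set.univ l}) ∧
    (1 < k →
      ({l | IsLinExtOn r Set.univ l} =
        ⋃ (p : Fin k × Fin k) (_ : p.1 ≠ p.2), {l | IsLinExtOn (rps p.1 p.2) Set.univ l}) ∧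
      ∀ p q : Fin k × Fin k, p.1 ≠ p.2 → q.1 ≠ q.2 → p ≠ q →
        Disjoint {l | IsLinExtOn (rps p.1 p.2) Set.univ l}
          {l | IsLinExtOn (rps q.1 q.2) Set.univ l}) ∧
    (greeneSum r x = ∑ i : Fin k, greeneSum (rp i) x) ∧
    (greeneSum r x = ∑ j : Fin k, greeneSum (rs j) x) ∧
    (1 < k → greeneSum r x =
      ∑ i : Fin k, ∑ j ∈ Finset.univ.erase i, greeneSum (rps i j) x) := by
  have : Nonempty (Fin k) := ⟨⟨0, hk⟩⟩
  have irr := hr.irrefl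
  obtain ⟨fst_cover, fst_disjoint, fst_sum⟩ :=
    linExt_partition_of_strictlyReverses hr x (Finset.univ : Finset (Fin k))
    (fun i a b => r a b ∨ (a = z i ∧ ∃ j, j ≠ i ∧ b = z j))
    (by
      rintro i - a (h | ⟨rfl, j, hj, h⟩)
      · exact irr a h
      · exact hj (hz h).symm)
    (by
      intro f hf
      simp only [strictlyReverses_or, strictlyReverses_fst, Finset.mem_univ, true_and,
        exists_and_left]
      exact (and_iff_left (exists_forall_ne_lt_of_injective (hf.comp hz))).symm)
    (by
      intro f i _ j _ hi hj
      rw [strictlyReverses_or, strictlyReverses_fst] at hi hj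
      exact eq_of_forall_ne_lt (f := f ∘ z) hi.2 hj.2)
  obtain ⟨snd_cover, snd_disjoint, snd_sum⟩ :=
    linExt_partition_of_strictlyReverses hr x (Finset.univ : Finset (Fin k))
    (fun j a b => r a b ∨ (b = z j ∧ ∃ i, i ≠ j ∧ a = z i))
    (by
      rintro i - a (h | ⟨rfl, j, hj, h⟩)
      · exact irr a h
      · exact hj (hz h).symm)
    (by
      intro f hf
      simp only [strictlyReverses_or, strictlyReverses_snd, Finset.mem_univ, true_and,
        exists_and_left]
      exact (and_iff_left (exists_forall_ne_gt_of_injective (hf.comp hz))).symm)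
    (by
      intro f i _ j _ hi hj
      rw [strictlyReverses_or, strictlyReverses_snd] at hi hj
      exact eq_of_forall_ne_gt (f := f ∘ z) hi.2 hj.2)
  have pairs (hk' : 1 < k) := linExt_partition_of_strictlyReverses hr x
    (Finset.univ.filter fun p : Fin k × Fin k => p.1 ≠ p.2)
    (fun p a b => r a b ∨ (a = z p.1 ∧ ∃ l, l ≠ p.1 ∧ b = z l) ∨
      (b = z p.2 ∧ ∃ l, l ≠ p.2 ∧ a = z l))
    (by
      rintro p - a (h | ⟨rfl, j, hj, h⟩ | ⟨rfl, j, hj, h⟩)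
      · exact irr a h
      · exact hj (hz h).symm
      · exact hj (hz h).symm)
    (by
      intro f hf
      simp only [strictlyReverses_or, strictlyReverses_fst, strictlyReverses_snd,
        Finset.mem_filter, Finset.mem_univ, true_and]
      refine ⟨fun h => ?_, fun ⟨_, _, h, _⟩ => h⟩
      obtain ⟨i, hi⟩ := exists_forall_ne_lt_of_injective (hf.comp hz)
      obtain ⟨j, hj⟩ := exists_forall_ne_gt_of_injective (hf.comp hz)
      refine ⟨(i, j), ?_, h, hi, hj⟩
      change i ≠ j
      rintro rfl
      have : Nontrivial (Fin k) := Fin.nontrivial_iff_two_le.2 hk'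
      obtain ⟨l, hl⟩ := exists_ne i
      exact (hi l hl).asymm (hj l hl))
    (by
      intro f p _ q _ hp hq
      simp only [strictlyReverses_or, strictlyReverses_fst, strictlyReverses_snd] at hp hq
      exact Prod.ext (eq_of_forall_ne_lt (f := f ∘ z) hp.2.1 hq.2.1)
        (eq_of_forall_ne_gt (f := f ∘ z) hp.2.2 hq.2.2))
  simp only [hrp, hrs, hrps]
  refine ⟨by simpa using fst_cover,
    fun i j => fst_disjoint i (Finset.mem_univ i) j (Finset.mem_univ j),
    by simpa using snd_cover, fun i j => snd_disjoint i (Finset.mem_univ i) j (Finset.mem_univ j),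
    fun hk' => ⟨?_, fun p q hp hq => (pairs hk').2.1 p (by simpa using hp) q (by simpa using hq)⟩,
    fst_sum, snd_sum, fun hk' => ?_⟩
  · simpa only [Finset.mem_filter, Finset.mem_univ, true_and] using (pairs hk').1
  · rw [(pairs hk').2.2]
    exact Finset.sum_finset_product _ Finset.univ (fun i => Finset.univ.erase i)
      (by simp [eq_comm])

end
end

section
/- Let P be the poset on Z_k ∪ X_n = {z_1,…,z_k} ∪ {x_1,…,x_n} in which x_j ≺ z_i for all i, j and no other pairs are comparable. Then G(P) = (−1)^{k−1} Δ_{Z_k}[1/f] = (−1)^{k} Δ_{X_n}[1/h], where f(x) = ∏_{j=1}^n (x − x_j) and h(z) = ∏_{i=1}^k (z − z_i). -/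
open scoped Classical

noncomputable section

/-- The product of the inverses of the consecutive differences of a nonempty word. -/
def chainProd {K : Type*} [Field K] {n : ℕ} (w : Fin (n + 1) → K) : K :=
  ∏ i : Fin n, (w i.castSucc - w i.succ)⁻¹

section ChainProd

variable {K : Type*} [Field K]

theorem chainProd_succ {n : ℕ} (w : Fin (n + 2) → K) :
    chainProd w = (w 0 - w 1)⁻¹ * chainProd (fun i => w i.succ) := by
  simp only [chainProd]
  rw [Fin.prod_univ_succ]
  rfl

theorem chainProd_rev {n : ℕ} (w : Fin (n + 1) → K) :
    chainProd (fun i => w i.rev) = (-1) ^ n * chainProd w := by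
  simp only [chainProd]
  rw [← Equiv.prod_comp Fin.revPerm]
  have h : ((-1 : K)) ^ n = ∏ _i : Fin n, (-1 : K) := by simp
  rw [h, ← Finset.prod_mul_distrib]
  refine Finset.prod_congr rfl fun i _ => ?_
  rw [Fin.revPerm_apply, Fin.rev_castSucc, Fin.rev_succ, Fin.rev_rev, ← neg_sub, inv_neg,
    neg_one_mul]

theorem prod_consecutive_append {k n : ℕ} (u : Fin (k + 1) → K) (v : Fin (n + 1) → K) :
    ∏ m : Fin (k + 1 + (n + 1) - 1),
        (Fin.append u v (idxLo m) - Fin.append u v (idxHi m))⁻¹ =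
      chainProd u * (u (Fin.last k) - v 0)⁻¹ * chainProd v := by
  change ∏ m : Fin (k + 1 + n),
    (Fin.append u v (idxLo (n := k + 1 + (n + 1)) m) -
      Fin.append u v (idxHi (n := k + 1 + (n + 1)) m))⁻¹ = _
  rw [Fin.prod_univ_add, Fin.prod_univ_castSucc]
  simp only [chainProd]
  congr 1
  · congr 1
    · refine Finset.prod_congr rfl fun i _ => ?_
      rw [← Fin.append_left u v i.castSucc, ← Fin.append_left u v i.succ]
      rfl
    · rw [← Fin.append_left u v (Fin.last k), ← Fin.append_right u v 0]
      rfl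
  · refine Finset.prod_congr rfl fun i _ => ?_
    rw [← Fin.append_right u v i.castSucc, ← Fin.append_right u v i.succ]
    rfl

theorem dividedDiff_inv_sub {n : ℕ} (x : Fin (n + 1) → K) (hx : Function.Injective x) (a : K)
    (ha : ∀ j, a ≠ x j) :
    dividedDiff x (fun w => (a - w)⁻¹) = ∏ j, (a - x j)⁻¹ := by
  have h := Lagrange.eval_interpolate_not_at_node (s := Finset.univ) (v := x) (x := a) 1
    fun i _ => ha i
  rw [Lagrange.interpolate_one hx.injOn Finset.univ_nonempty, Polynomial.eval_one,
    Lagrange.eval_nodal] at h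
  rw [Finset.prod_inv_distrib, eq_comm, inv_eq_of_mul_eq_one_right]
  rw [h]
  congr 1
  refine Finset.sum_congr rfl fun i _ => ?_
  rw [Pi.one_apply, mul_one, mul_comm, Lagrange.nodalWeight, Finset.prod_inv_distrib]

theorem prod_swap_succ {n : ℕ} (p : Fin (n + 1)) (f : Fin (n + 1) → K) :
    ∏ j : Fin n, f (Equiv.swap 0 p j.succ) = ∏ i ∈ Finset.univ.erase p, f i := by
  refine Finset.prod_nbij (fun j => Equiv.swap 0 p j.succ) ?_ ?_ ?_ fun _ _ => rfl
  · intro j _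
    rw [Finset.mem_erase]
    refine ⟨fun h => ?_, Finset.mem_univ _⟩
    rw [Equiv.swap_apply_eq_iff, Equiv.swap_apply_right] at h
    exact Fin.succ_ne_zero j h
  · intro i _ j _ h
    exact Fin.succ_injective _ ((Equiv.swap 0 p).injective h)
  · intro i hi
    have hip : i ≠ p := by simpa using hi
    have h0 : Equiv.swap 0 p i ≠ 0 := fun h => hip <| by
      rw [Equiv.swap_apply_eq_iff, Equiv.swap_apply_left] at h
      exact h
    obtain ⟨j, hj⟩ := Fin.exists_succ_eq.mpr h0
    exact ⟨j, by simp, by simp [hj]⟩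

/-- Summing over all words in the given letters, weighted by a function of the first letter. -/
theorem sum_head_mul_chainProd {n : ℕ} (x : Fin (n + 1) → K) (hx : Function.Injective x)
    (φ : K → K) :
    ∑ σ : Equiv.Perm (Fin (n + 1)), φ (x (σ 0)) * chainProd (fun i => x (σ i)) =
      dividedDiff x φ := by
  induction n generalizing φ with
  | zero => simp [chainProd, dividedDiff]
  | succ n ih =>
    rw [← Equiv.sum_comp Equiv.Perm.decomposeFin.symm, Fintype.sum_prod_type, dividedDiff]
    refine Finset.sum_congr rfl fun p _ => ?_
    have hy : Function.Injective fun j : Fin (n + 1) => x (Equiv.swap 0 p j.succ) :=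
      hx.comp ((Equiv.swap 0 p).injective.comp (Fin.succ_injective _))
    have hp : ∀ j : Fin (n + 1), x p ≠ x (Equiv.swap 0 p j.succ) := fun j h => by
      have h' := hx h
      rw [eq_comm, Equiv.swap_apply_eq_iff, Equiv.swap_apply_right] at h'
      exact Fin.succ_ne_zero j h'
    have h := ih _ hy fun w => (x p - w)⁻¹
    rw [dividedDiff_inv_sub _ hy _ hp, prod_swap_succ p fun i => (x p - x i)⁻¹,
      Finset.prod_inv_distrib] at h
    rw [← h, Finset.mul_sum]
    refine Finset.sum_congr rfl fun e _ => ?_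
    rw [chainProd_succ]
    simp only [Equiv.Perm.decomposeFin_symm_apply_zero, Equiv.Perm.decomposeFin_symm_apply_one,
      Equiv.Perm.decomposeFin_symm_apply_succ]

/-- Summing over all words in the given letters, weighted by a function of the last letter. -/
theorem sum_chainProd_mul_last {n : ℕ} (x : Fin (n + 1) → K) (hx : Function.Injective x)
    (φ : K → K) :
    ∑ σ : Equiv.Perm (Fin (n + 1)), chainProd (fun i => x (σ i)) * φ (x (σ (Fin.last n))) =
      (-1) ^ n * dividedDiff x φ := by
  rw [← sum_head_mul_chainProd x hx, ← Equiv.sum_comp (Equiv.mulRight Fin.revPerm),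
    Finset.mul_sum]
  refine Finset.sum_congr rfl fun σ _ => ?_
  have h := chainProd_rev fun i => x (σ i)
  simp only [Equiv.coe_mulRight, Equiv.Perm.mul_apply, Fin.revPerm_apply, Fin.rev_last, h]
  ring

end ChainProd

/-- The Greene sum may be computed with any enumeration of the elements. -/
theorem greeneSum_eq_sum_equiv {ι : Type*} [Fintype ι] [DecidableEq ι] {K : Type*} [Field K]
    (r : ι → ι → Prop) (x : ι → K) {N : ℕ} (e : Fin N ≃ ι) :
    greeneSum r x = ∑ σ : Equiv.Perm ι,
      if ∀ i j : Fin N, r (σ (e i)) (σ (e j)) → j < i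
      then ∏ m : Fin (N - 1), (x (σ (e (idxLo m))) - x (σ (e (idxHi m))))⁻¹
      else 0 := by
  obtain rfl : N = Fintype.card ι := by simpa using Fintype.card_congr e
  rw [greeneSum]
  refine Fintype.sum_equiv (Equiv.equivCongr e (Fintype.equivFin ι).symm) _ _ fun α => ?_
  simp

/-- Linear extensions of the two-level poset are pairs of orderings of the two levels. -/
theorem greeneSum_two_levels_eq_sum {K : Type*} [Field K] {k n : ℕ}
    (r : Fin (k + 1) ⊕ Fin (n + 1) → Fin (k + 1) ⊕ Fin (n + 1) → Prop)
    (hr : ∀ a b, r a b ↔ a.isRight ∧ b.isLeft)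
    (zv : Fin (k + 1) → K) (xv : Fin (n + 1) → K) :
    greeneSum r (Sum.elim zv xv) =
      ∑ s : Equiv.Perm (Fin (k + 1)), ∑ t : Equiv.Perm (Fin (n + 1)),
        chainProd (fun i => zv (s i)) * (zv (s (Fin.last k)) - xv (t 0))⁻¹ *
          chainProd (fun i => xv (t i)) := by
  rw [greeneSum_eq_sum_equiv _ _ finSumFinEquiv.symm, ← Finset.sum_filter,
    ← Fintype.sum_prod_type']
  symm
  refine Finset.sum_nbij (Equiv.Perm.sumCongrHom _ _) ?_ ?_ ?_ ?_
  · rintro ⟨s, t⟩ -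
    rw [Finset.mem_filter]
    refine ⟨Finset.mem_univ _, fun i j => ?_⟩
    induction i using Fin.addCases <;> induction j using Fin.addCases <;>
      simp [hr]
    rw [Fin.lt_def, Fin.val_natAdd, Fin.val_castAdd]
    omega
  · exact Equiv.Perm.sumCongrHom_injective.injOn
  · intro σ hσ
    have hσ' := (Finset.mem_filter.mp hσ).2
    have hmaps : Set.MapsTo σ (Set.range Sum.inl) (Set.range Sum.inl) := by
      by_contra hl
      have hr' := mt (Equiv.Perm.perm_mapsTo_inl_iff_mapsTo_inr σ).mpr hl
      simp only [Set.MapsTo, Set.forall_mem_range, not_forall] at hl hr'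
      obtain ⟨i, hi⟩ := hl
      obtain ⟨j, hj⟩ := hr'
      have h := hσ' (Fin.castAdd _ i) (Fin.natAdd _ j)
      rw [finSumFinEquiv_symm_apply_castAdd, finSumFinEquiv_symm_apply_natAdd] at h
      rcases hi' : σ (Sum.inl i) with a | a
      · exact hi ⟨a, hi'.symm⟩
      rcases hj' : σ (Sum.inr j) with b | b
      · rw [hi', hj', hr] at h
        have := h ⟨rfl, rfl⟩
        rw [Fin.lt_def, Fin.val_natAdd, Fin.val_castAdd] at this
        omega
      · exact hj ⟨b, hj'.symm⟩
    obtain ⟨st, h⟩ := Equiv.Perm.mem_sumCongrHom_range_of_perm_mapsTo_inl hmaps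
    exact ⟨st, by simp, h⟩
  · rintro ⟨s, t⟩ -
    have h : ∀ p, Sum.elim zv xv (Equiv.Perm.sumCongrHom _ _ (s, t) (finSumFinEquiv.symm p)) =
        Fin.append (fun i => zv (s i)) (fun i => xv (t i)) p := fun p => by
      induction p using Fin.addCases <;> simp
    simp only [h, prod_consecutive_append]

/-- For the poset on `Z_k ∪ X_n` in which `x_j ≺ z_i` for all `i, j`
and no other pairs are comparable,
`G(P) = (−1)^{k−1} Δ_{Z_k}[1/f] = (−1)^k Δ_{X_n}[1/h]`, where `f(x) = ∏_j (x − x_j)`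
and `h(z) = ∏_i (z − z_i)`. -/
theorem greeneSum_two_levels
    {K : Type*} [Field K] [CharZero K]
    {k n : ℕ} (hk : 0 < k) (hn : 0 < n)
    (zv : Fin k → K) (xv : Fin n → K)
    (hinj : Function.Injective (Sum.elim zv xv : Fin k ⊕ Fin n → K)) :
    greeneSum
        (fun a b : Fin k ⊕ Fin n =>
          match a, b with
          | Sum.inr _, Sum.inl _ => True
          | _, _ => False)
        (Sum.elim zv xv) =
      (-1 : K) ^ (k - 1) * dividedDiff zv (fun w => (∏ j : Fin n, (w - xv j))⁻¹) ∧
    greeneSum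
        (fun a b : Fin k ⊕ Fin n =>
          match a, b with
          | Sum.inr _, Sum.inl _ => True
          | _, _ => False)
        (Sum.elim zv xv) =
      (-1 : K) ^ k * dividedDiff xv (fun w => (∏ i : Fin k, (w - zv i))⁻¹) := by
  obtain ⟨k, rfl⟩ := Nat.exists_eq_add_one.mpr hk
  obtain ⟨n, rfl⟩ := Nat.exists_eq_add_one.mpr hn
  have hz : Function.Injective zv := hinj.comp Sum.inl_injective
  have hx : Function.Injective xv := hinj.comp Sum.inr_injective
  have hne : ∀ i j, zv i ≠ xv j := fun i j h =>
    Sum.inl_ne_inr (hinj (a₁ := .inl i) (a₂ := .inr j) h)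
  rw [greeneSum_two_levels_eq_sum _ (by rintro (a | a) (b | b) <;> simp)]
  constructor
  · rw [Nat.add_sub_cancel, ← sum_chainProd_mul_last zv hz]
    refine Finset.sum_congr rfl fun s _ => ?_
    rw [← Finset.prod_inv_distrib, ← dividedDiff_inv_sub xv hx _ fun j => hne _ j,
      ← sum_head_mul_chainProd xv hx, Finset.mul_sum]
    exact Finset.sum_congr rfl fun t _ => mul_assoc _ _ _
  · rw [Finset.sum_comm, ← sum_head_mul_chainProd xv hx, Finset.mul_sum]
    refine Finset.sum_congr rfl fun t _ => ?_
    have hneg : ∀ w, (w - xv (t 0))⁻¹ = -(xv (t 0) - w)⁻¹ := fun w => by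
      rw [← inv_neg, neg_sub]
    have h := sum_chainProd_mul_last zv hz fun w => (xv (t 0) - w)⁻¹
    rw [dividedDiff_inv_sub zv hz _ fun i => (hne i _).symm, Finset.prod_inv_distrib] at h
    rw [← Finset.sum_mul]
    simp only [hneg, mul_neg, Finset.sum_neg_distrib, h]
    ring

end
end

section
/- Let z_1,…,z_k be pairwise distinct elements of a field, let c_1,…,c_k be arbitrary elements of the field, and let 1 ≤ p ≤ k. Then the ratio of determinants det(z_i^{p−1}c_i, z_i^{p−2}c_i, …, z_i c_i, c_i, z_i^{k−p−1}, …, z_i, 1)_{i=1}^k / det(z_i^{k−1}, z_i^{k−2}, …, z_i, 1)_{i=1}^k (where the listed entries form the i-th row) equals Σ_{I ⊆ {1,…,k}, |I| = p} (∏_{i ∈ I} c_i) / (∏_{i ∈ I, j ∉ I} (z_i − z_j)). -/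
open scoped Classical

noncomputable section

open Polynomial in
/-- Replacing the monomials `x ^ (k - 1 - j)` by monic polynomials of the same degree does not
change a Vandermonde determinant (with columns in order of decreasing degree). -/
theorem det_eval_monic_eq_det_pow_rev {R : Type*} [CommRing R] {k : ℕ} (z : Fin k → R)
    (q : Fin k → R[X]) (hdeg : ∀ j, (q j).natDegree = k - 1 - j.1) (hq : ∀ j, (q j).Monic) :
    (Matrix.of fun i j : Fin k => (q j).eval (z i)).det =
      (Matrix.of fun i j : Fin k => z i ^ (k - 1 - j.1)).det := by
  have h := Matrix.det_eval_matrixOfPolynomials_eq_det_vandermonde z (fun j => q j.rev)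
    (fun j => by rw [hdeg, Fin.val_rev]; omega) (fun j => hq _)
  have h1 := Matrix.det_permute' Fin.revPerm
    (Matrix.of fun i j : Fin k => (q j.rev).eval (z i))
  have h2 := Matrix.det_permute' Fin.revPerm (Matrix.vandermonde z)
  rw [h, ← h1] at h2
  convert h2.symm using 2
  · ext i j
    simp
  · ext i j
    simp only [Matrix.of_apply, Matrix.submatrix_apply, Matrix.vandermonde_apply, id,
      Fin.revPerm_apply, Fin.val_rev]
    congr 1
    omega

/-- The determinant of `z_i ^ (k - 1 - j)` does not vanish at pairwise distinct nodes. -/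
theorem det_pow_rev_ne_zero {K : Type*} [Field K] {k : ℕ} (z : Fin k → K)
    (hz : Function.Injective z) :
    (Matrix.of fun i j : Fin k => z i ^ (k - 1 - j.1)).det ≠ 0 := by
  have h2 := Matrix.det_permute' Fin.revPerm (Matrix.vandermonde z)
  have : (Matrix.of fun i j : Fin k => z i ^ (k - 1 - j.1)) =
      (Matrix.vandermonde z).submatrix id Fin.revPerm := by
    ext i j
    simp only [Matrix.of_apply, Matrix.submatrix_apply, Matrix.vandermonde_apply, id,
      Fin.revPerm_apply, Fin.val_rev]
    congr 1
    omega
  rw [this, h2]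
  refine mul_ne_zero ?_ (Matrix.det_vandermonde_ne_zero_iff.2 hz)
  rcases Int.units_eq_one_or (Equiv.Perm.sign (Fin.revPerm (n := k))) with h | h <;> simp [h]

/-- Leibniz expansion after multiplying each entry `A i j` with `j ∈ J` by `c i`: the factors
contributed by a permutation depend only on the image of `J`. -/
theorem det_mul_rows_on_columns {R n : Type*} [CommRing R] [Fintype n]
    [DecidableEq n]
    (A : Matrix n n R) (c : n → R) (J : Finset n) :
    (Matrix.of fun i j => if j ∈ J then A i j * c i else A i j).det =
      ∑ σ : Equiv.Perm n, (∏ i ∈ J.map σ.toEmbedding, c i) *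
        (Equiv.Perm.sign σ • ∏ j, A (σ j) j) := by
  rw [Matrix.det_apply]
  refine Finset.sum_congr rfl fun σ _ => ?_
  rw [Finset.prod_map, mul_smul_comm]
  congr 1
  have : ∀ j, (Matrix.of fun i j => if j ∈ J then A i j * c i else A i j) (σ j) j =
      (if j ∈ J then c (σ j) else 1) * A (σ j) j := by
    intro j
    by_cases h : j ∈ J <;> simp [h, mul_comm]
  rw [Finset.prod_congr rfl fun j _ => this j, Finset.prod_mul_distrib]
  simp [Finset.prod_ite_mem]

/-- The part of the Leibniz expansion given by the permutations that send the first `p` columns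
to `I`, for the matrix with columns `z_i ^ (p - 1 - j)`, `j < p`, and `z_i ^ (k - 1 - j)`,
`j ≥ p`. -/
theorem sum_perm_map_eq_mul_prod_sub {K : Type*} [Field K] {k : ℕ} (z : Fin k → K)
    (p : ℕ) (hpk : p ≤ k) (J : Finset (Fin k)) (hJ : ∀ j, j ∈ J ↔ j.1 < p) (hJp : J.card = p)
    (I : Finset (Fin k)) (hI : I.card = p) :
    (∑ σ : Equiv.Perm (Fin k) with J.map σ.toEmbedding = I, Equiv.Perm.sign σ • ∏ j : Fin k,
        (if j.1 < p then z (σ j) ^ (p - 1 - j.1) else z (σ j) ^ (k - 1 - j.1))) *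
      (∏ i ∈ I, ∏ j ∈ Iᶜ, (z i - z j)) =
    (Matrix.of fun i j : Fin k => z i ^ (k - 1 - j.1)).det := by
  set P : Polynomial K := ∏ j ∈ Iᶜ, (Polynomial.X - Polynomial.C (z j)) with hP
  have hPm : P.Monic := Polynomial.monic_prod_of_monic _ _ fun j _ => Polynomial.monic_X_sub_C _
  have hPd : P.natDegree = k - p := by
    rw [hP, Polynomial.natDegree_prod_of_monic _ _ fun j _ => Polynomial.monic_X_sub_C _]
    simp [Finset.card_compl, hI]
  have hPe : ∀ x, P.eval x = ∏ j ∈ Iᶜ, (x - z j) := fun x => by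
    simp [hP, Polynomial.eval_prod]
  rw [← det_eval_monic_eq_det_pow_rev z
    (fun j => if j.1 < p then Polynomial.X ^ (p - 1 - j.1) * P else Polynomial.X ^ (k - 1 - j.1))]
  rotate_left
  · intro j
    split_ifs with h
    · rw [(Polynomial.monic_X_pow _).natDegree_mul hPm, hPd, Polynomial.natDegree_X_pow]
      omega
    · exact Polynomial.natDegree_X_pow _
  · intro j
    split_ifs with h
    · exact (Polynomial.monic_X_pow _).mul hPm
    · exact Polynomial.monic_X_pow _
  rw [Matrix.det_apply, Finset.sum_mul, Finset.sum_filter]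
  refine Finset.sum_congr rfl fun σ _ => ?_
  split_ifs with h
  · rw [smul_mul_assoc]
    congr 1
    have : ∏ i ∈ I, ∏ j ∈ Iᶜ, (z i - z j) =
        ∏ j : Fin k, if j ∈ J then P.eval (z (σ j)) else 1 := by
      rw [← h, Finset.prod_map, h]
      simp [Finset.prod_ite_mem, hPe]
    rw [this, ← Finset.prod_mul_distrib]
    refine Finset.prod_congr rfl fun j _ => ?_
    by_cases hj : j.1 < p <;> simp [hJ, hj]
  · obtain ⟨j, hjJ, hj⟩ : ∃ j ∈ J, σ j ∉ I := by
      by_contra! hc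
      refine h (Finset.eq_of_subset_of_card_le ?_ ?_)
      · intro i hi
        obtain ⟨j, hj, rfl⟩ := Finset.mem_map.1 hi
        exact hc j hj
      · rw [Finset.card_map, hI, hJp]
    rw [Finset.prod_eq_zero (Finset.mem_univ j), smul_zero]
    simp only [Matrix.of_apply, if_pos ((hJ j).1 hjJ), Polynomial.eval_mul, hPe]
    rw [Finset.prod_eq_zero (Finset.mem_compl.2 hj) (sub_self _), mul_zero]

/-- For pairwise distinct `z_1, …, z_k`, arbitrary `c_1, …, c_k` and
`1 ≤ p ≤ k`, the ratio of the determinant with `i`-th row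
`(z_i^{p−1}c_i, …, z_i c_i, c_i, z_i^{k−p−1}, …, z_i, 1)` by the Vandermonde
determinant equals `Σ_{|I|=p} (∏_{i∈I} c_i)/(∏_{i∈I, j∉I} (z_i − z_j))`. -/
theorem det_ratio_eq_sum_subsets
    {K : Type*} [Field K]
    {k : ℕ} (z : Fin k → K) (hz : Function.Injective z) (c : Fin k → K)
    (p : ℕ) (hp1 : 1 ≤ p) (hpk : p ≤ k) :
    Matrix.det (Matrix.of fun i j : Fin k =>
        if j.1 < p then z i ^ (p - 1 - j.1) * c i else z i ^ (k - 1 - j.1)) /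
      Matrix.det (Matrix.of fun i j : Fin k => z i ^ (k - 1 - j.1)) =
    ∑ I ∈ Finset.powersetCard p (Finset.univ : Finset (Fin k)),
      (∏ i ∈ I, c i) * (∏ i ∈ I, ∏ j ∈ Iᶜ, (z i - z j))⁻¹ := by
  rw [div_eq_iff (det_pow_rev_ne_zero z hz), Finset.sum_mul]
  set J : Finset (Fin k) := Finset.univ.filter fun j => j.1 < p with hJdef
  have hJ : ∀ j, j ∈ J ↔ j.1 < p := fun j => by simp [hJdef]
  have hJp : J.card = p := by
    rw [hJdef, Fin.card_filter_val_lt, min_eq_right hpk]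
  let A : Matrix (Fin k) (Fin k) K := Matrix.of fun i j =>
    if j.1 < p then z i ^ (p - 1 - j.1) else z i ^ (k - 1 - j.1)
  have hM : (Matrix.of fun i j : Fin k =>
      if j.1 < p then z i ^ (p - 1 - j.1) * c i else z i ^ (k - 1 - j.1)) =
      Matrix.of fun i j : Fin k => if j ∈ J then A i j * c i else A i j := by
    ext i j
    by_cases hj : j.1 < p <;> simp [A, hJ, hj]
  rw [hM, det_mul_rows_on_columns, ← Finset.sum_fiberwise_of_maps_to
    (t := Finset.powersetCard p Finset.univ) (g := fun σ => J.map σ.toEmbedding)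
    fun σ _ => by simp [Finset.mem_powersetCard, hJp]]
  refine Finset.sum_congr rfl fun I hI => ?_
  have hIp := (Finset.mem_powersetCard.1 hI).2
  have hne : ∏ i ∈ I, ∏ j ∈ Iᶜ, (z i - z j) ≠ 0 :=
    Finset.prod_ne_zero_iff.2 fun i hi => Finset.prod_ne_zero_iff.2 fun j hj =>
      sub_ne_zero.2 fun h => Finset.mem_compl.1 hj (hz h ▸ hi)
  rw [← sum_perm_map_eq_mul_prod_sub z p hpk J hJ hJp I hIp, mul_assoc,
    mul_comm _ (∏ i ∈ I, ∏ j ∈ Iᶜ, (z i - z j)), inv_mul_cancel_left₀ hne, Finset.mul_sum]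
  refine Finset.sum_congr rfl fun σ hσ => ?_
  rw [(Finset.mem_filter.1 hσ).2]
  rfl

end
end

section
/- Let z_1,…,z_k be pairwise distinct elements of a field, φ a function defined at these nodes, and 1 ≤ p ≤ k. Then Σ_{I ⊆ {1,…,k}, |I| = p} (∏_{i ∈ I} φ(z_i)) / (∏_{i ∈ I, j ∉ I} (z_i − z_j)) = det( Δ_{Z_{i, k−p+j}}[φ] )_{i,j=1}^{p}, where Z_{a,b} = {z_a, z_{a+1}, …, z_b} for a ≤ b, Δ_{Z_{a,b}}[φ] is the divided difference of φ at the nodes z_a,…,z_b, and Δ_{Z_{a,b}}[φ] = 0 by convention when a > b. -/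
open scoped Classical

noncomputable section

/-- The Newton divided difference `Δ_{Z_{a,b}}[φ]` at the consecutive nodes
`z a, z (a+1), …, z b` (equal to `0` when `a > b`). -/
def ddIcc {K : Type*} [Field K] (z : ℕ → K) (φ : K → K) (a b : ℕ) : K :=
  ∑ m ∈ Finset.Icc a b, φ (z m) * (∏ i ∈ (Finset.Icc a b).erase m, (z m - z i))⁻¹

/-- Cauchy–Binet formula: the product of complementary minors is a function `F` of the set of
selected indices, and the determinant is the sum of its values over the `p`-subsets of `s`. -/
theorem det_sum_mul_eq_sum_powersetCard {R α : Type*} [CommRing R] [DecidableEq α] {p : ℕ}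
    (s : Finset α)
    (A : Fin p → α → R) (B : α → Fin p → R) (F : Finset α → R)
    (hF : ∀ f : Fin p → α, Function.Injective f → (∀ i, f i ∈ s) →
      Matrix.det (Matrix.of fun i j => A i (f j)) * Matrix.det (Matrix.of fun i j => B (f i) j) =
        F (Finset.univ.image f)) :
    Matrix.det (Matrix.of fun i j : Fin p => ∑ m ∈ s, A i m * B m j) =
      ∑ I ∈ Finset.powersetCard p s, F I := by
  have hrows : Matrix.det (Matrix.of fun i j : Fin p => ∑ m ∈ s, A i m * B m j) =
      ∑ f ∈ Fintype.piFinset (fun _ : Fin p => s),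
        (∏ i, A i (f i)) * Matrix.det (Matrix.of fun i j => B (f i) j) := by
    have h := (Matrix.detRowAlternating (R := R) (n := Fin p)).toMultilinearMap.map_sum_finset
      (fun i m => A i m • B m) (fun _ => s)
    simp only [MultilinearMap.map_smul_univ] at h
    convert! h using 1
    change Matrix.det _ = Matrix.det _
    congr 1
    ext i j
    simp [Finset.sum_apply]
  have hinj : ∑ f ∈ Fintype.piFinset (fun _ : Fin p => s),
        (∏ i, A i (f i)) * Matrix.det (Matrix.of fun i j => B (f i) j) =
      ∑ f ∈ (Fintype.piFinset (fun _ : Fin p => s)).filter Function.Injective,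
        (∏ i, A i (f i)) * Matrix.det (Matrix.of fun i j => B (f i) j) := by
    refine (Finset.sum_filter_of_ne fun f _ hf => ?_).symm
    by_contra hni
    obtain ⟨a, b, hab, hne⟩ := Function.not_injective_iff.mp hni
    refine hf ?_
    rw [Matrix.det_zero_of_row_eq hne (by ext j; simp [hab]), mul_zero]
  have hmaps : ∀ f ∈ (Fintype.piFinset (fun _ : Fin p => s)).filter Function.Injective,
      Finset.univ.image f ∈ Finset.powersetCard p s := by
    intro f hf
    rw [Finset.mem_filter, Fintype.mem_piFinset] at hf
    rw [Finset.mem_powersetCard]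
    refine ⟨Finset.image_subset_iff.mpr fun i _ => hf.1 i, ?_⟩
    rw [Finset.card_image_of_injective _ hf.2, Finset.card_univ, Fintype.card_fin]
  rw [hrows, hinj, ← Finset.sum_fiberwise_of_maps_to hmaps]
  refine Finset.sum_congr rfl fun I hI => ?_
  rw [Finset.mem_powersetCard] at hI
  obtain ⟨e⟩ : Nonempty (Fin p ≃ I) :=
    ⟨(Fintype.equivFinOfCardEq (by rw [Fintype.card_coe, hI.2])).symm⟩
  have he_inj : Function.Injective fun i => (e i : α) :=
    Subtype.val_injective.comp e.injective
  have he_im : Finset.univ.image (fun i => (e i : α)) = I := by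
    ext a
    simp only [Finset.mem_image, Finset.mem_univ, true_and]
    exact ⟨fun ⟨i, hi⟩ => hi ▸ (e i).2, fun ha => ⟨e.symm ⟨a, ha⟩, by simp⟩⟩
  have hFI := hF _ he_inj fun i => hI.1 (e i).2
  rw [he_im] at hFI
  rw [← hFI, ← Matrix.det_transpose, Matrix.det_apply', Finset.sum_mul]
  symm
  refine Finset.sum_bij (fun σ _ i => (e (σ i) : α)) ?_ ?_ ?_ ?_
  · intro σ _
    have hσ : Finset.univ.image (fun i => (e (σ i) : α)) = I := by
      refine Eq.trans ?_ he_im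
      ext a
      simp only [Finset.mem_image, Finset.mem_univ, true_and]
      exact ⟨fun ⟨i, hi⟩ => ⟨σ i, hi⟩, fun ⟨i, hi⟩ => ⟨σ.symm i, by simpa using hi⟩⟩
    simp only [Finset.mem_filter, Fintype.mem_piFinset]
    exact ⟨⟨fun i => hI.1 (e (σ i)).2, he_inj.comp σ.injective⟩, hσ⟩
  · intro σ _ τ _ h
    ext1 i
    exact he_inj (congrFun h i)
  · intro f hf
    simp only [Finset.mem_filter, Fintype.mem_piFinset] at hf
    have hfI : ∀ i, f i ∈ I := fun i => hf.2 ▸ Finset.mem_image_of_mem f (Finset.mem_univ i)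
    have hbij : Function.Bijective fun i => e.symm ⟨f i, hfI i⟩ := by
      rw [← Finite.injective_iff_bijective]
      intro a b hab
      exact hf.1.2 (congrArg Subtype.val (e.symm.injective hab))
    exact ⟨Equiv.ofBijective _ hbij, Finset.mem_univ _, by ext i; simp⟩
  · intro σ _
    have hperm := Matrix.det_permute σ (Matrix.of fun i j => B (e i) j)
    have hsub : (Matrix.of fun i j => B (e i) j).submatrix σ id =
        Matrix.of fun i j => B (e (σ i)) j := rfl
    rw [hsub] at hperm
    rw [hperm]
    simp only [Matrix.transpose_apply, Matrix.of_apply]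
    ring

/-- The product of the Vandermonde determinants for two triangular families of monic polynomials,
one listed by increasing and one by decreasing degree, is the product of all differences. -/
theorem det_eval_mul_det_eval_rev {R : Type*} [CommRing R] {p : ℕ} (v : Fin p → R)
    (P Q : Fin p → Polynomial R) (hP : ∀ i, (P i).natDegree = i) (hPm : ∀ i, (P i).Monic)
    (hQ : ∀ i, (Q i).natDegree = i.rev) (hQm : ∀ i, (Q i).Monic) :
    Matrix.det (Matrix.of fun i j => (P i).eval (v j)) *
      Matrix.det (Matrix.of fun i j => (Q j).eval (v i)) =
    ∏ i, ∏ j ∈ Finset.univ.erase i, (v i - v j) := by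
  have h1 : Matrix.det (Matrix.of fun i j => (P i).eval (v j)) =
      ∏ i, ∏ j ∈ Finset.Ioi i, (v j - v i) := by
    rw [← Matrix.det_transpose, ← Matrix.det_vandermonde,
      Matrix.det_eval_matrixOfPolynomials_eq_det_vandermonde v P hP hPm]
    rfl
  have h2 : Matrix.det (Matrix.of fun i j => (Q j).eval (v i)) =
      ∏ i, ∏ j ∈ Finset.Ioi i, (v i - v j) := by
    rw [← Matrix.det_submatrix_equiv_self Fin.revPerm,
      show (Matrix.of fun i j => (Q j).eval (v i)).submatrix Fin.revPerm Fin.revPerm =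
        Matrix.of fun i j => (Q (Fin.rev j)).eval (v (Fin.rev i)) from rfl,
      ← Matrix.det_eval_matrixOfPolynomials_eq_det_vandermonde (fun i => v i.rev)
        (fun i => Q i.rev) (fun i => by rw [hQ, Fin.rev_rev]) (fun i => hQm _),
      Matrix.det_vandermonde, Finset.prod_sigma', Finset.prod_sigma']
    refine Finset.prod_bij' (fun x _ => ⟨x.2.rev, x.1.rev⟩) (fun x _ => ⟨x.2.rev, x.1.rev⟩)
      ?_ ?_ ?_ ?_ ?_ <;> simp
  have h3 : ∏ i, ∏ j ∈ Finset.Ioi i, (v j - v i) = ∏ i, ∏ j ∈ Finset.Iio i, (v i - v j) :=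
    Finset.prod_comm' (by simp)
  rw [h1, h2, h3, ← Finset.prod_mul_distrib]
  refine Finset.prod_congr rfl fun i _ => ?_
  rw [← Finset.prod_union (Finset.disjoint_left.mpr fun a ha hb =>
    lt_asymm (Finset.mem_Iio.mp ha) (Finset.mem_Ioi.mp hb))]
  refine Finset.prod_congr ?_ fun _ _ => rfl
  ext a
  simp [lt_or_lt_iff_ne]

/-- Extending a divided difference to all nodes `z 0, …, z (k - 1)`: the summands outside
`Finset.Icc a b` vanish. -/
theorem ddIcc_eq_sum_range {K : Type*} [Field K] {k : ℕ} (z : ℕ → K)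
    (hz : Set.InjOn z (Set.Iio k)) (φ : K → K) (a b : ℕ) (ha : a ≤ k) (hb : b < k) :
    ddIcc z φ a b = ∑ m ∈ Finset.range k, (∏ i ∈ Finset.range a, (z m - z i)) *
      ((φ (z m) * (∏ i ∈ (Finset.range k).erase m, (z m - z i))⁻¹) *
        ∏ i ∈ Finset.Ioo b k, (z m - z i)) := by
  rw [ddIcc]
  refine Finset.sum_subset_zero_on_sdiff (fun m hm => ?_) (fun m hm => ?_) fun m hm => ?_
  · rw [Finset.mem_Icc] at hm
    exact Finset.mem_range.mpr (by omega)
  · simp only [Finset.mem_sdiff, Finset.mem_range, Finset.mem_Icc] at hm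
    by_cases hma : m < a
    · rw [Finset.prod_eq_zero (Finset.mem_range.mpr hma) (sub_self _), zero_mul]
    · rw [Finset.prod_eq_zero (s := Finset.Ioo b k) (i := m)
        (Finset.mem_Ioo.mpr (by omega)) (sub_self _), mul_zero, mul_zero]
  · rw [Finset.mem_Icc] at hm
    have hsplit : (Finset.range k).erase m =
        (Finset.range a ∪ Finset.Ioo b k) ∪ (Finset.Icc a b).erase m := by
      ext i
      simp only [Finset.mem_erase, Finset.mem_range, Finset.mem_union, Finset.mem_Ioo,
        Finset.mem_Icc]
      omega
    have hne : ∀ i, i < k → i ≠ m → z m - z i ≠ 0 := fun i hi him h =>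
      him (hz (Set.mem_Iio.mpr hi) (Set.mem_Iio.mpr (by omega)) (sub_eq_zero.mp h).symm)
    have hd1 : Disjoint (Finset.range a) (Finset.Ioo b k) := by
      rw [Finset.disjoint_left]
      simp only [Finset.mem_range, Finset.mem_Ioo]
      omega
    have hd2 : Disjoint (Finset.range a ∪ Finset.Ioo b k) ((Finset.Icc a b).erase m) := by
      rw [Finset.disjoint_left]
      simp only [Finset.mem_range, Finset.mem_Ioo, Finset.mem_union, Finset.mem_erase,
        Finset.mem_Icc]
      omega
    have h1 : ∏ i ∈ Finset.range a, (z m - z i) ≠ 0 := Finset.prod_ne_zero_iff.mpr fun i hi => by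
      rw [Finset.mem_range] at hi
      exact hne i (by omega) (by omega)
    have h2 : ∏ i ∈ Finset.Ioo b k, (z m - z i) ≠ 0 := Finset.prod_ne_zero_iff.mpr fun i hi => by
      rw [Finset.mem_Ioo] at hi
      exact hne i (by omega) (by omega)
    rw [hsplit, Finset.prod_union hd2, Finset.prod_union hd1, mul_inv, mul_inv]
    field_simp

/-- For pairwise distinct nodes `z_1, …, z_k` (here `z 0, …, z (k-1)`),
a function `φ` and `1 ≤ p ≤ k`,
`Σ_{|I|=p} (∏_{i∈I} φ(z_i))/(∏_{i∈I, j∉I}(z_i − z_j)) = det(Δ_{Z_{i,k−p+j}}[φ])_{i,j=1}^p`,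
with the convention `Δ_{Z_{a,b}}[φ] = 0` for `a > b`. -/
theorem sum_subsets_eq_det_dividedDiff
    {K : Type*} [Field K]
    {k : ℕ} (z : ℕ → K) (hz : Set.InjOn z (Set.Iio k)) (φ : K → K)
    (p : ℕ) (hp1 : 1 ≤ p) (hpk : p ≤ k) :
    ∑ I ∈ Finset.powersetCard p (Finset.range k),
      (∏ i ∈ I, φ (z i)) * (∏ i ∈ I, ∏ j ∈ Finset.range k \ I, (z i - z j))⁻¹ =
    Matrix.det (Matrix.of fun i j : Fin p => ddIcc z φ i.1 (k - p + j.1)) := by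
  have hM : (Matrix.of fun i j : Fin p => ddIcc z φ i.1 (k - p + j.1)) =
      Matrix.of fun i j : Fin p => ∑ m ∈ Finset.range k, (∏ l ∈ Finset.range i, (z m - z l)) *
        ((φ (z m) * (∏ l ∈ (Finset.range k).erase m, (z m - z l))⁻¹) *
          ∏ l ∈ Finset.Ioo (k - p + j) k, (z m - z l)) := by
    ext i j
    exact ddIcc_eq_sum_range z hz φ _ _ (by omega) (by omega)
  rw [hM, det_sum_mul_eq_sum_powersetCard (Finset.range k)
    (fun i m => ∏ l ∈ Finset.range i, (z m - z l)) _ (fun I =>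
      (∏ i ∈ I, (φ (z i) * (∏ l ∈ (Finset.range k).erase i, (z i - z l))⁻¹)) *
        ∏ i ∈ I, ∏ j ∈ I.erase i, (z i - z j))]
  · refine Finset.sum_congr rfl fun I hI => ?_
    have hIk := (Finset.mem_powersetCard.mp hI).1
    rw [← Finset.prod_inv_distrib, ← Finset.prod_mul_distrib, ← Finset.prod_mul_distrib]
    refine Finset.prod_congr rfl fun i hi => ?_
    have hsplit : (Finset.range k).erase i = (Finset.range k \ I) ∪ I.erase i := by
      ext j
      have := @hIk j
      simp only [Finset.mem_erase, Finset.mem_union, Finset.mem_sdiff]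
      grind
    have hdisj : Disjoint (Finset.range k \ I) (I.erase i) :=
      Finset.sdiff_disjoint.mono_right (Finset.erase_subset _ _)
    have hne : ∏ j ∈ I.erase i, (z i - z j) ≠ 0 := Finset.prod_ne_zero_iff.mpr fun j hj h =>
      Finset.ne_of_mem_erase hj (hz (Set.mem_Iio.mpr (Finset.mem_range.mp
        (hIk (Finset.mem_of_mem_erase hj)))) (Set.mem_Iio.mpr (Finset.mem_range.mp (hIk hi)))
        (sub_eq_zero.mp h).symm)
    rw [hsplit, Finset.prod_union hdisj, mul_inv, mul_assoc, mul_assoc, inv_mul_cancel₀ hne,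
      mul_one]
  · intro f hf _
    have hV := det_eval_mul_det_eval_rev (fun i => z (f i))
      (fun i : Fin p => Lagrange.nodal (Finset.range i) z)
      (fun j : Fin p => Lagrange.nodal (Finset.Ioo (k - p + j) k) z)
      (fun i => by rw [Lagrange.natDegree_nodal, Finset.card_range])
      (fun i => Lagrange.nodal_monic)
      (fun i => by rw [Lagrange.natDegree_nodal, Nat.card_Ioo, Fin.val_rev]; omega)
      (fun i => Lagrange.nodal_monic)
    simp only [Lagrange.eval_nodal] at hV
    rw [Finset.prod_image hf.injOn, Finset.prod_image hf.injOn]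
    simp only [← Finset.image_erase hf, Finset.prod_image hf.injOn]
    rw [← hV, mul_left_comm]
    congr 1
    exact Matrix.det_mul_column _ _

end
end

section
/- Let x_1, x_2, … be pairwise distinct complex numbers, H a function, and t_1,…,t_p pairwise distinct points distinct from all x_j. Suppose that for each i = 1,…,p and each t ∈ {t_1,…,t_p} the Newton interpolation series H(t) = Σ_{j ≥ i} Δ_{X_{i,j}}[H] · R(t, X_{i,j−1}) converges absolutely, where X_{a,b} = {x_a,…,x_b}, R(t, X_{a,b}) = ∏_{l=a}^{b}(t − x_l) (empty product = 1), and Δ_{X_{a,b}}[H] is the divided difference of H at x_a,…,x_b. Then ∏_{i=1}^{p} H(t_i) = Σ_{j_1 < j_2 < ⋯ < j_p} det( Δ_{X_{i, j_l}}[H] )_{i,l=1}^{p} · det( R(t_i, X_{1, j_l − 1}) )_{i,l=1}^{p} / det( t_i^{l−1} )_{i,l=1}^{p}, the outer sum being over increasing p-tuples j_1 < ⋯ < j_p of positive integers with j_l ≥ l, with Δ_{X_{i,j}}[H] = 0 for i > j. -/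
open scoped Classical

noncomputable section

theorem summable_norm_and_hasSum_pi_prod {R ι : Type*} [NormedCommRing R] [CompleteSpace R]
    {n : ℕ} {f : Fin n → ι → R} {a : Fin n → R} (hf : ∀ i, Summable fun j => ‖f i j‖)
    (ha : ∀ i, HasSum (f i) (a i)) :
    (Summable fun J : Fin n → ι => ‖∏ i, f i (J i)‖) ∧
      HasSum (fun J : Fin n → ι => ∏ i, f i (J i)) (∏ i, a i) := by
  induction n with
  | zero =>
    refine ⟨(hasSum_fintype _).summable, ?_⟩
    simp
  | succ n ih =>
    obtain ⟨hs, hS⟩ := ih (fun i : Fin n => hf i.succ) (fun i => ha i.succ)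
    rw [← (Fin.consEquiv fun _ : Fin (n + 1) => ι).summable_iff,
      ← (Fin.consEquiv fun _ : Fin (n + 1) => ι).hasSum_iff]
    simp only [Function.comp_def, Fin.consEquiv_apply, Fin.prod_univ_succ, Fin.cons_zero,
      Fin.cons_succ]
    have hmul := Summable.mul_norm (f := f 0)
      (g := fun J : Fin n → ι => ∏ i : Fin n, f i.succ (J i)) (hf 0) hs
    exact ⟨hmul, HasSum.mul (g := fun J : Fin n → ι => ∏ i : Fin n, f i.succ (J i))
      (ha 0) hS hmul.of_norm⟩

theorem HasSum.pi_prod_of_summable_norm {R ι : Type*} [NormedCommRing R] [CompleteSpace R]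
    {n : ℕ} {f : Fin n → ι → R} {a : Fin n → R} (hf : ∀ i, Summable fun j => ‖f i j‖)
    (ha : ∀ i, HasSum (f i) (a i)) :
    HasSum (fun J : Fin n → ι => ∏ i, f i (J i)) (∏ i, a i) :=
  (summable_norm_and_hasSum_pi_prod hf ha).2

theorem injective_strictMono_comp_perm {n : ℕ} {ι : Type*} [LinearOrder ι] :
    Function.Injective fun P : {J : Fin n → ι // StrictMono J} × Equiv.Perm (Fin n) =>
      P.1.1 ∘ P.2 := by
  rintro ⟨⟨J, hJ⟩, σ⟩ ⟨⟨J', hJ'⟩, τ⟩ h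
  dsimp only at h
  have hr : Set.range J = Set.range J' := by
    rw [← σ.surjective.range_comp J, ← τ.surjective.range_comp J', h]
  obtain rfl := (hJ.range_inj hJ').1 hr
  have : σ = τ := Equiv.ext fun i => hJ.injective (congrFun h i)
  rw [this]

theorem exists_strictMono_comp_perm {n : ℕ} {ι : Type*} [LinearOrder ι] {f : Fin n → ι}
    (hf : Function.Injective f) :
    f ∈ Set.range fun P : {J : Fin n → ι // StrictMono J} × Equiv.Perm (Fin n) =>
      P.1.1 ∘ P.2 := by
  refine ⟨(⟨f ∘ Tuple.sort f, (Tuple.monotone_sort f).strictMono_of_injective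
    (hf.comp (Tuple.sort f).injective)⟩, (Tuple.sort f)⁻¹), ?_⟩
  ext i
  simp

/-- The Cauchy–Binet formula for `n × ι` matrices with absolutely convergent row products. -/
theorem hasSum_det_mul_det {R ι : Type*} [NormedCommRing R] [CompleteSpace R] [LinearOrder ι]
    {n : ℕ} {A B : Fin n → ι → R} {C : Matrix (Fin n) (Fin n) R}
    (hs : ∀ i q, Summable fun j => ‖A i j * B q j‖)
    (hC : ∀ i q, HasSum (fun j => A i j * B q j) (C q i)) :
    HasSum (fun J : {J : Fin n → ι // StrictMono J} =>
      Matrix.det (Matrix.of fun i l => A i (J.1 l)) *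
        Matrix.det (Matrix.of fun i l => B i (J.1 l))) C.det := by
  have hfun : HasSum (fun f : Fin n → ι =>
      (∏ i, A i (f i)) * Matrix.det (Matrix.of fun q l => B q (f l))) C.det := by
    simp only [Matrix.det_apply', Finset.mul_sum]
    refine hasSum_sum fun σ _ => ?_
    convert! (HasSum.pi_prod_of_summable_norm (fun i => hs i (σ i))
      (fun i => hC i (σ i))).mul_left ((Equiv.Perm.sign σ : ℤ) : R) using 2 with f
    simp only [Matrix.of_apply, Finset.prod_mul_distrib]
    ring
  rw [← injective_strictMono_comp_perm.hasSum_iff] at hfun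
  · refine hfun.prod_fiberwise fun J => ?_
    convert! hasSum_fintype _ using 1
    rw [← Matrix.det_transpose, Matrix.det_apply', Finset.sum_mul]
    refine Finset.sum_congr rfl fun σ _ => ?_
    have := Matrix.det_permute' σ (Matrix.of fun q l => B q (J.1 l))
    simp only [Function.comp_apply, Matrix.transpose_apply, Matrix.of_apply]
    rw [show (Matrix.of fun q l => B q (J.1 (σ l))) =
      (Matrix.of fun q l => B q (J.1 l)).submatrix id σ from rfl, this]
    ring
  · intro f hf
    have hinj : ¬ Function.Injective f := fun h => hf (exists_strictMono_comp_perm h)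
    obtain ⟨a, b, hab, hne⟩ := by simpa [Function.Injective] using hinj
    rw [Matrix.det_zero_of_column_eq hne fun q => by simp [hab], mul_zero]

theorem det_prod_range_sub {R : Type*} [CommRing R] [Nontrivial R] (x : ℕ → R) {n : ℕ}
    (t : Fin n → R) :
    Matrix.det (Matrix.of fun q i : Fin n => ∏ m ∈ Finset.range i.1, (t q - x m)) =
      (Matrix.vandermonde t).det := by
  rw [Matrix.det_eval_matrixOfPolynomials_eq_det_vandermonde t
    (fun i => ∏ m ∈ Finset.range i.1, (Polynomial.X - Polynomial.C (x m)))
    (fun i => by simp [Polynomial.natDegree_finsetProd_X_sub_C_eq_card])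
    (fun i => Polynomial.monic_prod_X_sub_C _ _)]
  simp [Polynomial.eval_prod]

theorem ddIcc_mul_prod_range {K : Type*} [Field K] (z : ℕ → K) (φ : K → K) (s : K) (i j : ℕ) :
    ddIcc z φ i j * ∏ m ∈ Finset.range j, (s - z m) =
      (∏ m ∈ Finset.range i, (s - z m)) *
        (ddIcc z φ i j * ∏ l ∈ Finset.Ico i j, (s - z l)) := by
  rcases le_or_gt i j with h | h
  · rw [← Finset.prod_range_mul_prod_Ico _ h]
    ring
  · simp [ddIcc, Finset.Icc_eq_empty_of_lt h]

/-- (Generalized Newton interpolation series.) If for each `i = 1,…,p`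
and each of the points `t_1, …, t_p` the Newton series
`H(t) = Σ_{j≥i} Δ_{X_{i,j}}[H] R(t, X_{i,j−1})` converges absolutely, then
`∏_i H(t_i) = Σ_{j_1<⋯<j_p} det(Δ_{X_{i,j_l}}[H]) det(R(t_i, X_{1,j_l−1})) / det(t_i^{l−1})`. -/
theorem prod_newton_series
    (x : ℕ → ℂ) (hx : Function.Injective x) (H : ℂ → ℂ)
    {p : ℕ} (hp : 0 < p) (t : Fin p → ℂ) (ht : Function.Injective t)
    (htx : ∀ i : Fin p, ∀ m : ℕ, t i ≠ x m)
    (habs : ∀ i q : Fin p,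
      Summable fun j : ℕ => ‖ddIcc x H i.1 j * ∏ l ∈ Finset.Ico i.1 j, (t q - x l)‖)
    (hsum : ∀ i q : Fin p,
      HasSum (fun j : ℕ => ddIcc x H i.1 j * ∏ l ∈ Finset.Ico i.1 j, (t q - x l))
        (H (t q))) :
    HasSum
      (fun J : {J : Fin p → ℕ // StrictMono J} =>
        Matrix.det (Matrix.of fun i l : Fin p => ddIcc x H i.1 (J.1 l)) *
          Matrix.det (Matrix.of fun i l : Fin p =>
            ∏ m ∈ Finset.range (J.1 l), (t i - x m)) /
          Matrix.det (Matrix.of fun i l : Fin p => t i ^ l.1))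
      (∏ i : Fin p, H (t i)) := by
  have hV : (Matrix.vandermonde t).det ≠ 0 := Matrix.det_vandermonde_ne_zero_iff.2 ht
  have key := hasSum_det_mul_det (A := fun i j => ddIcc x H i.1 j)
    (B := fun q j => ∏ m ∈ Finset.range j, (t q - x m))
    (C := Matrix.of fun q i : Fin p => H (t q) * ∏ m ∈ Finset.range i.1, (t q - x m))
    (fun i q => by
      simp only [ddIcc_mul_prod_range, norm_mul (∏ m ∈ Finset.range i.1, (t q - x m))]
      exact (habs i q).mul_left _)
    (fun i q => by
      simp only [ddIcc_mul_prod_range, Matrix.of_apply, mul_comm (H (t q))]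
      exact (hsum i q).mul_left _)
  have hdet := Matrix.det_mul_column (fun q => H (t q))
    (Matrix.of fun q i : Fin p => ∏ m ∈ Finset.range i.1, (t q - x m))
  simp only [Matrix.of_apply] at hdet
  rw [hdet, det_prod_range_sub] at key
  simpa only [mul_div_cancel_right₀ _ hV] using! key.div_const (Matrix.vandermonde t).det

end
end
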